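/- Let n, t, ℓ₁, …, ℓ_t be natural numbers with ℓ_i ≥ 3 for each i ∈ [t] and ℓ₁ + ⋯ + ℓ_t = n. For any strongly 10⁵¹t-connected n-vertex semicomplete digraph D and any t distinct vertices x₁, …, x_t of D, there exist pairwise vertex-disjoint directed cycles C₁, …, C_t in D such that for each i ∈ [t], x_i ∈ V(C_i) and |V(C_i)| = ℓ_i. -/

import Mathlib

/-- A digraph on the vertex type `V`, given by its adjacency (directed edge) relation. -/
structure Digr (V : Type) where
  Adj : V → V → Prop

namespace Digr

variable {V : Type}

/-- No loops. -/
def Loopless (G : Digr V) : Prop := ∀ v, ¬ G.Adj v v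

/-- A tournament: every pair of distinct vertices is joined by exactly one directed edge. -/
def IsTournament (G : Digr V) : Prop :=
  G.Loopless ∧ ∀ u v : V, u ≠ v → (G.Adj u v ↔ ¬ G.Adj v u)

/-- A semicomplete digraph: every pair of distinct vertices is joined by at least one
directed edge (edges in both directions are allowed). -/
def IsSemicomplete (G : Digr V) : Prop :=
  G.Loopless ∧ ∀ u v : V, u ≠ v → (G.Adj u v ∨ G.Adj v u)

/-- Out-neighbourhood `N⁺_G(v)`. -/
def outN (G : Digr V) (v : V) : Set V := {u | G.Adj v u}

/-- In-neighbourhood `N⁻_G(v)`. -/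
def inN (G : Digr V) (v : V) : Set V := {u | G.Adj u v}

/-- Union of two digraphs (on the same vertex type). -/
def union (G H : Digr V) : Digr V := ⟨fun a b => G.Adj a b ∨ H.Adj a b⟩

/-- `l` is a directed path of `G` lying inside the vertex set `A`, from `u` to `v`. -/
def IsPathOn (G : Digr V) (A : Set V) (u v : V) (l : List V) : Prop :=
  l.Nodup ∧ l.Chain' G.Adj ∧ (∀ x ∈ l, x ∈ A) ∧ l.head? = some u ∧ l.getLast? = some v

/-- There is a directed path of `G` inside `A` from `u` to `v`. -/
def Reaches (G : Digr V) (A : Set V) (u v : V) : Prop :=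
  ∃ l, G.IsPathOn A u v l

/-- The induced subdigraph of `G` on `W` is strongly `k`-connected: `|W| ≥ k + 1` and for
every ordered pair of distinct vertices of `W` and every `S ⊆ W ∖ {u,v}` with `|S| ≤ k - 1`
there is a directed path from `u` to `v` avoiding `S`. -/
def StronglyConnOn (G : Digr V) (W : Set V) (k : ℕ) : Prop :=
  k + 1 ≤ W.ncard ∧
  ∀ u ∈ W, ∀ v ∈ W, u ≠ v → ∀ S : Set V, S ⊆ W \ {u, v} → S.ncard < k →
    G.Reaches (W \ S) u v

/-- Strong `c`-connectedness for a real parameter `c` (the condition on the removed set `S`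
is `|S| ≤ c - 1`). -/
def StronglyConnOnR (G : Digr V) (W : Set V) (c : ℝ) : Prop :=
  c + 1 ≤ (W.ncard : ℝ) ∧
  ∀ u ∈ W, ∀ v ∈ W, u ≠ v → ∀ S : Set V, S ⊆ W \ {u, v} → (S.ncard : ℝ) ≤ c - 1 →
    G.Reaches (W \ S) u v

/-- `l` is a directed cycle of `G` (length at least 3) whose vertex set is `C`. -/
def IsCycleOn (G : Digr V) (C : Set V) (l : List V) : Prop :=
  3 ≤ l.length ∧ l.Nodup ∧ (∀ x, x ∈ l ↔ x ∈ C) ∧ l.Chain' G.Adj ∧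
  ∃ a b, l.getLast? = some a ∧ l.head? = some b ∧ G.Adj a b

/-- The pair `(v, U)` is `k`-connected in the induced subdigraph of `G` on `A`: after
deleting any `S ⊆ A ∖ {v}` with `|S| ≤ k - 1` there is a path from `v` to some vertex
of `U ∖ S` inside `A ∖ S`. -/
def VtxSetConn (G : Digr V) (A : Set V) (v : V) (U : Set V) (k : ℕ) : Prop :=
  ∀ S : Set V, S ⊆ A \ {v} → S.ncard < k → ∃ u ∈ U \ S, G.Reaches (A \ S) v u

/-- The pair `(U, v)` is `k`-connected in the induced subdigraph of `G` on `A`. -/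
def SetVtxConn (G : Digr V) (A : Set V) (U : Set V) (v : V) (k : ℕ) : Prop :=
  ∀ S : Set V, S ⊆ A \ {v} → S.ncard < k → ∃ u ∈ U \ S, G.Reaches (A \ S) u v

end Digr

open Digr

namespace SemicompleteCycles

open Finset Relation
open scoped Classical

noncomputable section

variable {V : Type}

/-- `v` can be reached from `u` along edges of `r` inside `S`. -/
def Rch (r : V → V → Prop) (S : Finset V) : V → V → Prop :=
  ReflTransGen fun a b => r a b ∧ a ∈ S ∧ b ∈ S

/-- The subdigraph of `r` induced on `S` is strongly connected. -/
def StrongOn (r : V → V → Prop) (S : Finset V) : Prop :=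
  ∀ u ∈ S, ∀ v ∈ S, Rch r S u v

/-- `r` is a loopless semicomplete digraph. -/
def Semi (r : V → V → Prop) : Prop :=
  (∀ v, ¬ r v v) ∧ ∀ u v, u ≠ v → r u v ∨ r v u

/-- A directed cycle, given as a list of distinct vertices. -/
def Cyc (r : V → V → Prop) (l : List V) : Prop :=
  l.Nodup ∧ l.IsChain r ∧ ∀ a ∈ l.getLast?, ∀ b ∈ l.head?, r a b

variable {r : V → V → Prop}

theorem Rch.mono {S T : Finset V} (h : S ⊆ T) {u v : V} (huv : Rch r S u v) : Rch r T u v :=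
  ReflTransGen.mono (fun _ _ hab => ⟨hab.1, h hab.2.1, h hab.2.2⟩) _ _ huv

theorem Rch.edge {S : Finset V} {u v : V} (hu : u ∈ S) (hv : v ∈ S) (h : r u v) : Rch r S u v :=
  ReflTransGen.single ⟨h, hu, hv⟩

theorem Rch.closed {S : Finset V} {C : V → Prop} (hC : ∀ a b, C a → r a b → a ∈ S → b ∈ S → C b)
    {u v : V} (h : Rch r S u v) (hu : C u) : C v := by
  induction h with
  | refl => exact hu
  | tail _ hbc ih => exact hC _ _ ih hbc.1 hbc.2.1 hbc.2.2

theorem rch_swap {S : Finset V} {u v : V} : Rch (Function.swap r) S u v ↔ Rch r S v u := by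
  unfold Rch
  rw [← reflTransGen_swap]
  constructor <;> intro h <;> refine ReflTransGen.mono ?_ _ _ h <;>
    rintro a b ⟨h1, h2, h3⟩ <;> exact ⟨h1, h3, h2⟩

theorem strongOn_swap {S : Finset V} : StrongOn (Function.swap r) S ↔ StrongOn r S :=
  ⟨fun h u hu v hv => rch_swap.1 (h v hv u hu), fun h u hu v hv => rch_swap.2 (h v hv u hu)⟩

theorem Semi.swap (h : Semi r) : Semi (Function.swap r) :=
  ⟨h.1, fun u v huv => (h.2 v u huv.symm)⟩

theorem Semi.of_not (h : Semi r) {u v : V} (huv : u ≠ v) (hn : ¬ r u v) : r v u :=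
  (h.2 u v huv).resolve_left hn

theorem strongOn_of_hub {S : Finset V} (a : V) (h₁ : ∀ v ∈ S, Rch r S a v)
    (h₂ : ∀ v ∈ S, Rch r S v a) : StrongOn r S :=
  fun u hu v hv => (h₂ u hu).trans (h₁ v hv)

theorem Cyc.rotate {l₁ l₂ : List V} (h : Cyc r (l₁ ++ l₂)) : Cyc r (l₂ ++ l₁) := by
  obtain ⟨hn, hc, he⟩ := h
  refine ⟨List.nodup_append_comm.1 hn, ?_, ?_⟩
  · rw [List.isChain_append] at hc ⊢
    refine ⟨hc.2.1, hc.1, fun x hx y hy => he x ?_ y ?_⟩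
    · cases l₂ with
      | nil => simp at hx
      | cons a l => simpa [List.getLast?_append] using hx
    · cases l₁ with
      | nil => simp at hy
      | cons a l => simpa using hy
  · intro a ha b hb
    cases l₁ with
    | nil => simp at ha hb ⊢; exact he a (by simpa using ha) b (by simpa using hb)
    | cons c l₁ =>
      cases l₂ with
      | nil => exact he a (by simpa using ha) b (by simpa using hb)
      | cons d l₂ =>
        rw [List.isChain_append] at hc
        refine hc.2.2 a ?_ b ?_
        · rw [List.getLast?_append_of_ne_nil _ (by simp)] at ha; exact ha
        · simpa using hb

theorem rch_of_isChain {u : V} {l : List V} (h : (u :: l).IsChain r) {S : Finset V}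
    (hS : ∀ a ∈ u :: l, a ∈ S) : ∀ v ∈ u :: l, Rch r S u v := by
  induction l generalizing u with
  | nil => intro v hv; simp at hv; subst hv; exact ReflTransGen.refl
  | cons a l ih =>
    intro v hv
    rw [List.isChain_cons_cons] at h
    rcases List.mem_cons.1 hv with rfl | hv
    · exact ReflTransGen.refl
    · exact (Rch.edge (hS u (by simp)) (hS a (by simp)) h.1).trans
        (ih h.2 (fun b hb => hS b (List.mem_cons_of_mem _ hb)) v hv)

theorem Cyc.strongOn {l : List V} (h : Cyc r l) : StrongOn r l.toFinset := by
  intro u hu v hv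
  obtain ⟨l₁, l₂, rfl⟩ := List.append_of_mem (List.mem_toFinset.1 hu)
  have h' : Cyc r (u :: (l₂ ++ l₁)) := by simpa using h.rotate
  refine rch_of_isChain h'.2.1 (fun a ha => ?_) v ?_
  · simp at ha ⊢; tauto
  · simp at hv ⊢; tauto

/-- Between a vertex sending an edge to `v` and the last vertex receiving one from `v`, there is
a place where `v` can be inserted. -/
theorem exists_insert (hs : Semi r) {v : V} : ∀ (l : List V) (a : V), v ∉ a :: l → r a v →
    (∀ b ∈ (a :: l).getLast?, ¬ r b v) →
    ∃ l₁ c d l₂, a :: l = l₁ ++ c :: d :: l₂ ∧ r c v ∧ r v d := by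
  intro l
  induction l with
  | nil => intro a _ h1 h2; exact absurd h1 (h2 a (by simp))
  | cons b l ih =>
    intro a hv h1 h2
    by_cases hb : r b v
    · obtain ⟨l₁, c, d, l₂, h, hc, hd⟩ := ih b (fun h => hv (List.mem_cons_of_mem _ h)) hb
        (fun x hx => h2 x (by simpa using hx))
      exact ⟨a :: l₁, c, d, l₂, by simp [h], hc, hd⟩
    · exact ⟨[], a, b, l, rfl, h1, hs.of_not (by rintro rfl; simp at hv) hb⟩

theorem Cyc.insert (hs : Semi r) {l : List V} (h : Cyc r l) {v a b : V} (hv : v ∉ l)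
    (ha : a ∈ l) (hb : b ∈ l) (hav : r a v) (hvb : r v b) :
    ∃ l', Cyc r l' ∧ List.Perm l' (v :: l) := by
  obtain ⟨s, e, rfl⟩ := List.append_of_mem hb
  have h' : Cyc r (b :: (e ++ s)) := by simpa using h.rotate
  have hp : List.Perm (b :: (e ++ s)) (s ++ b :: e) := by
    have := @List.perm_append_comm _ (b :: e) s
    simpa using this
  have hv' : v ∉ b :: (e ++ s) := fun hh => hv (hp.subset hh)
  have ha' : a ∈ b :: (e ++ s) := hp.symm.subset ha
  suffices H : ∃ l', Cyc r l' ∧ List.Perm l' (v :: b :: (e ++ s)) by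
    obtain ⟨l', h1, h2⟩ := H
    exact ⟨l', h1, h2.trans (hp.cons v)⟩
  generalize e ++ s = q at *
  by_cases hl : ∀ x ∈ (b :: q).getLast?, ¬ r x v
  · obtain ⟨p₁, p₂, hsplit⟩ := List.append_of_mem ha'
    obtain ⟨l₁, c, d, l₂, hh, hc, hd⟩ := exists_insert hs p₂ a
      (fun hx => hv' (by rw [hsplit]; exact List.mem_append_right _ hx)) hav
      (fun x hx => hl x (by rw [hsplit, List.getLast?_append_of_ne_nil _ (by simp)]; exact hx))
    have hq : b :: q = (p₁ ++ l₁ ++ [c]) ++ (d :: l₂) := by rw [hsplit, hh]; simp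
    rw [hq] at h' hv' ⊢
    have h2 := h'.rotate
    refine ⟨(d :: l₂) ++ (p₁ ++ l₁ ++ [c]) ++ [v], ⟨?_, ?_, ?_⟩, ?_⟩
    · rw [List.nodup_append]
      refine ⟨h2.1, by simp, ?_⟩
      rintro x hx y hy rfl
      simp only [List.mem_singleton] at hy; subst hy
      exact hv' (by simp only [List.mem_append] at hx ⊢; tauto)
    · rw [List.isChain_append]
      refine ⟨h2.2.1, by simp, ?_⟩
      intro x hx y hy
      rw [← List.append_assoc, List.getLast?_append_of_ne_nil _ (by simp)] at hx
      simp at hx hy; subst hx; subst hy; exact hc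
    · intro x hx y hy
      rw [List.getLast?_append_of_ne_nil _ (by simp)] at hx
      simp at hx hy; subst hx; subst hy; exact hd
    · refine (List.perm_append_comm).trans ?_
      simp only [List.singleton_append]
      exact (List.perm_append_comm).cons v
  · push Not at hl
    obtain ⟨x, hx, hxv⟩ := hl
    refine ⟨v :: b :: q, ⟨List.nodup_cons.2 ⟨hv', h'.1⟩, ?_, ?_⟩, List.Perm.refl _⟩
    · rw [List.isChain_cons_cons]; exact ⟨hvb, h'.2.1⟩
    · intro y hy z hz
      rw [List.getLast?_cons_cons] at hy
      have : y = x := Option.mem_unique hy hx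
      simp at hz; subst hz; rw [this]; exact hxv

/-- In a strong semicomplete digraph, a vertex receiving all edges between it and `C` leads to a
vertex sending all edges between it and `C`, unless some vertex does neither. -/
theorem exists_out_in (hs : Semi r) {S C : Finset V} (hS : StrongOn r S) (hCS : C ⊂ S)
    (hC : C.Nonempty) (hmix : ∀ v ∈ S, v ∉ C → ∀ a ∈ C, ∀ b ∈ C, r a v → ¬ r v b) :
    ∃ o ∈ S, ∃ w ∈ S, o ∉ C ∧ w ∉ C ∧ o ≠ w ∧ r o w ∧ (∀ c ∈ C, r c o) ∧ ∀ c ∈ C, r w c := by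
  obtain ⟨c₀, hc₀⟩ := hC
  obtain ⟨v₀, hv₀, hv₀C⟩ := (Finset.ssubset_iff_of_subset hCS.1).1 hCS
  have ho : ∃ o ∈ S, o ∉ C ∧ ∀ b ∈ C, ¬ r o b := by
    by_contra! hcon
    have : v₀ ∈ C := by
      refine Rch.closed (C := fun x => x ∈ C) ?_ (hS c₀ (hCS.1 hc₀) v₀ hv₀) hc₀
      intro a b ha hab _ hb
      by_contra hbC
      obtain ⟨c, hc, hbc⟩ := hcon b hb hbC
      exact hmix b hb hbC a ha c hc hab hbc
    exact hv₀C this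
  obtain ⟨o₀, ho₀, ho₀C, ho₀n⟩ := ho
  have : ∃ o ∈ S, ∃ w ∈ S, (o ∉ C ∧ ∀ b ∈ C, ¬ r o b) ∧ ¬ (w ∉ C ∧ ∀ b ∈ C, ¬ r w b) ∧ r o w := by
    by_contra! hcon
    have := Rch.closed (C := fun x => x ∉ C ∧ ∀ b ∈ C, ¬ r x b) ?_
      (hS o₀ ho₀ c₀ (hCS.1 hc₀)) ⟨ho₀C, ho₀n⟩
    · exact this.1 hc₀
    · intro a b ha hab haS hbS
      by_contra hb
      refine hcon a haS b hbS ha ?_ hab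
      push Not at hb
      exact hb
  obtain ⟨o, hoS, w, hwS, ⟨hoC, hon⟩, hw, how⟩ := this
  have hwC : w ∉ C := fun h => hon w h how
  push Not at hw
  obtain ⟨b, hb, hwb⟩ := hw hwC
  refine ⟨o, hoS, w, hwS, hoC, hwC, ?_, how, fun c hc => ?_, fun c hc => ?_⟩
  · rintro rfl; exact hs.1 _ how
  · exact hs.of_not (by rintro rfl; exact hoC hc) (hon c hc)
  · refine hs.of_not (by rintro rfl; exact hwC hc) fun hcw => hmix w hwS hwC c hc b hb hcw hwb

theorem Cyc.grow (hs : Semi r) {S : Finset V} (hS : StrongOn r S) {l : List V} {x : V}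
    (h : Cyc r l) (hx : x ∈ l) (hlen : 2 ≤ l.length) (hlS : l.toFinset ⊂ S) :
    ∃ l', Cyc r l' ∧ x ∈ l' ∧ l'.toFinset ⊆ S ∧ l'.length = l.length + 1 := by
  by_cases hmix : ∀ v ∈ S, v ∉ l.toFinset → ∀ a ∈ l.toFinset, ∀ b ∈ l.toFinset, r a v → ¬ r v b
  · obtain ⟨o, hoS, w, hwS, hoC, hwC, hne, how, hco, hwc⟩ :=
      exists_out_in hs hS hlS ⟨x, List.mem_toFinset.2 hx⟩ hmix
    have : ∃ y ∈ l, y ≠ x := by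
      by_contra! hall
      have := h.1
      match l, hlen, h.1, hall with
      | a :: b :: l, _, hnd, hall =>
        have h1 := hall a (by simp)
        have h2 := hall b (by simp)
        subst h1; subst h2; simp at hnd
    obtain ⟨y, hy, hyx⟩ := this
    obtain ⟨s, e, rfl⟩ := List.append_of_mem hy
    have h' : Cyc r (y :: (e ++ s)) := by simpa using h.rotate
    have hmem : ∀ z, z ∈ e ++ s → z ∈ (s ++ y :: e).toFinset := by
      intro z hz; simp at hz ⊢; tauto
    have hxq : x ∈ e ++ s := by simp at hx ⊢; tauto
    have hlq : (e ++ s).length + 1 = (s ++ y :: e).length := by simp; omega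
    rw [← hlq]
    have hsub : ∀ z ∈ e ++ s, z ∈ S := fun z hz => hlS.1 (hmem z hz)
    have hoq : o ∉ e ++ s := fun hz => hoC (hmem o hz)
    have hwq : w ∉ e ++ s := fun hz => hwC (hmem w hz)
    have hco' : ∀ c ∈ e ++ s, r c o := fun c hc => hco c (hmem c hc)
    have hwc' : ∀ c ∈ e ++ s, r w c := fun c hc => hwc c (hmem c hc)
    generalize e ++ s = q at *
    have hqne : q ≠ [] := List.ne_nil_of_mem hxq
    refine ⟨q ++ [o, w], ⟨?_, ?_, ?_⟩, by simp [hxq], ?_, by simp⟩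
    · rw [List.nodup_append]
      refine ⟨(List.nodup_cons.1 h'.1).2, by simp [hne], ?_⟩
      rintro a ha b hb rfl
      simp at hb; rcases hb with rfl | rfl
      · exact hoq ha
      · exact hwq ha
    · rw [List.isChain_append]
      refine ⟨h'.2.1.tail, by simp [how], ?_⟩
      intro a ha b hb
      simp at hb; subst hb
      exact hco' a (List.mem_of_getLast? ha)
    · intro a ha b hb
      rw [List.getLast?_append_of_ne_nil _ (by simp)] at ha
      simp at ha; subst ha
      refine hwc' b ?_
      cases q with
      | nil => exact absurd rfl hqne
      | cons c q => simp at hb; subst hb; simp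
    · intro z hz
      simp at hz
      rcases hz with hz | hz | hz
      all_goals first | exact hsub z hz | (subst hz; assumption)
  · push Not at hmix
    obtain ⟨v, hv, hvl, a, ha, b, hb, hav, hvb⟩ := hmix
    rw [List.mem_toFinset] at hvl ha hb
    obtain ⟨l', hl', hp⟩ := h.insert hs hvl ha hb hav hvb
    refine ⟨l', hl', hp.symm.subset (List.mem_cons_of_mem _ hx), ?_, by simpa using hp.length_eq⟩
    intro z hz
    have := hp.subset (List.mem_toFinset.1 hz)
    rcases List.mem_cons.1 this with rfl | h
    · exact hv
    · exact hlS.1 (List.mem_toFinset.2 h)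

/-- Vertex-pancyclicity of strong semicomplete digraphs. -/
theorem StrongOn.exists_cyc (hs : Semi r) {S : Finset V} (hS : StrongOn r S) {x : V} (hx : x ∈ S)
    {m : ℕ} (hm : 3 ≤ m) (hmS : m ≤ S.card) :
    ∃ l, Cyc r l ∧ x ∈ l ∧ l.toFinset ⊆ S ∧ l.length = m := by
  have base : ∃ l, Cyc r l ∧ x ∈ l ∧ l.toFinset ⊆ S ∧ 2 ≤ l.length ∧ l.length ≤ 3 := by
    by_cases hmix : ∀ v ∈ S, v ∉ ({x} : Finset V) → ∀ a ∈ ({x} : Finset V),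
        ∀ b ∈ ({x} : Finset V), r a v → ¬ r v b
    · have hss : ({x} : Finset V) ⊂ S := by
        refine (Finset.ssubset_iff_subset_ne).2 ⟨by simpa using hx, ?_⟩
        rintro rfl; simp at hmS; omega
      obtain ⟨o, hoS, w, hwS, hoC, hwC, hne, how, hco, hwc⟩ :=
        exists_out_in hs hS hss ⟨x, by simp⟩ hmix
      simp at hoC hwC hco hwc
      refine ⟨[x, o, w], ⟨?_, ?_, ?_⟩, by simp, ?_, by simp, by simp⟩
      · simp; exact ⟨⟨Ne.symm hoC, Ne.symm hwC⟩, hne⟩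
      · simp [hco, how]
      · simp [hwc]
      · intro z hz; simp at hz; rcases hz with rfl | rfl | rfl <;> assumption
    · push Not at hmix
      obtain ⟨v, hv, hvl, a, ha, b, hb, hav, hvb⟩ := hmix
      simp at ha hb hvl; subst ha; subst hb
      refine ⟨[b, v], ⟨by simp [Ne.symm hvl], by simp [hav], by simp [hvb]⟩, by simp, ?_, by simp,
        by simp⟩
      intro z hz; simp at hz; rcases hz with rfl | rfl <;> assumption
  have step : ∀ k, 3 ≤ k → k ≤ S.card →
      ∃ l, Cyc r l ∧ x ∈ l ∧ l.toFinset ⊆ S ∧ l.length = k := by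
    have grow : ∀ l : List V, Cyc r l → x ∈ l → l.toFinset ⊆ S → 2 ≤ l.length →
        l.length + 1 ≤ S.card →
        ∃ l', Cyc r l' ∧ x ∈ l' ∧ l'.toFinset ⊆ S ∧ l'.length = l.length + 1 := by
      intro l hl hxl hlS h2 h3
      refine hl.grow hs hS hxl h2 ((Finset.ssubset_iff_subset_ne).2 ⟨hlS, ?_⟩)
      rintro rfl
      rw [List.toFinset_card_of_nodup hl.1] at h3; omega
    intro k hk
    induction k, hk using Nat.le_induction with
    | base =>
      intro hk
      obtain ⟨l, h1, h2, h3, h4, h5⟩ := base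
      rcases (by omega : l.length = 2 ∨ l.length = 3) with h | h
      · obtain ⟨l', h⟩ := grow l h1 h2 h3 h4 (by omega)
        exact ⟨l', h.1, h.2.1, h.2.2.1, by omega⟩
      · exact ⟨l, h1, h2, h3, h⟩
    | succ k hk ih =>
      intro hkS
      obtain ⟨l, h1, h2, h3, h4⟩ := ih (by omega)
      obtain ⟨l', h⟩ := grow l h1 h2 h3 (by omega) (by omega)
      exact ⟨l', h.1, h.2.1, h.2.2.1, by omega⟩
  exact step m hm hmS

theorem StrongOn.exists_subset (hs : Semi r) {S : Finset V} (hS : StrongOn r S) {x : V}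
    (hx : x ∈ S) {m : ℕ} (hm : 3 ≤ m) (hmS : m ≤ S.card) :
    ∃ T ⊆ S, x ∈ T ∧ StrongOn r T ∧ T.card = m := by
  obtain ⟨l, h1, h2, h3, h4⟩ := hS.exists_cyc hs hx hm hmS
  exact ⟨l.toFinset, h3, List.mem_toFinset.2 h2, h1.strongOn,
    by rw [List.toFinset_card_of_nodup h1.1, h4]⟩

end

noncomputable section

variable {V : Type} {r : V → V → Prop}

/-- The subdigraph induced on `W` stays strong after deleting fewer than `k` vertices. -/
def Kc (r : V → V → Prop) (W : Finset V) (k : ℕ) : Prop :=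
  ∀ S : Finset V, S.card < k → StrongOn r (W \ S)

theorem Kc.swap {W : Finset V} {k : ℕ} (h : Kc r W k) : Kc (Function.swap r) W k :=
  fun S hS => strongOn_swap.2 (h S hS)

theorem Kc.sdiff {W : Finset V} {k : ℕ} (h : Kc r W k) (R : Finset V) {k' : ℕ}
    (hk : k' + R.card ≤ k) : Kc r (W \ R) k' := by
  intro S hS
  rw [sdiff_sdiff_left]
  exact h _ ((card_union_le _ _).trans_lt (by omega))

theorem Kc.mono {W : Finset V} {k k' : ℕ} (h : Kc r W k) (hk : k' ≤ k) : Kc r W k' :=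
  fun S hS => h S (hS.trans_le hk)

/-- The out-neighbourhood as a finset. -/
def outN [Fintype V] (r : V → V → Prop) (v : V) : Finset V := univ.filter (r v)

@[simp] theorem mem_outN [Fintype V] {v w : V} : w ∈ outN r v ↔ r v w := by simp [outN]

theorem Kc.le_outN [Fintype V] (hs : Semi r) {k : ℕ} (h : Kc r univ k)
    (hk : k + 1 ≤ Fintype.card V) (v : V) : k ≤ (outN r v).card := by
  by_contra! hlt
  have hv : v ∉ outN r v := by simp [hs.1]
  have : ∃ w, w ∉ insert v (outN r v) := by
    by_contra! hall
    have h1 := card_le_card (fun w _ => hall w : (univ : Finset V) ⊆ insert v (outN r v))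
    have h2 := card_insert_le v (outN r v)
    rw [card_univ] at h1; omega
  obtain ⟨w, hw⟩ := this
  rw [mem_insert, not_or] at hw
  refine hw.1 (Rch.closed (C := fun x => x = v) ?_
    (h _ hlt v (by simp [hs.1]) w (by simpa using hw.2)) rfl)
  rintro a b rfl hab _ hb
  simp [hab] at hb

/-- Deleting a set on which a level function is injective lowers the connectivity by at most 4. -/
theorem Kc.sdiff_levels (hs : Semi r) {W Y : Finset V} {k : ℕ} (h : Kc r W (k + 4)) (f : V → ℕ)
    (hf : ∀ u ∈ W, ∀ v ∈ W, r u v → f v ≤ f u + 1) (hY : Y ⊆ W) (hinj : Set.InjOn f Y) :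
    Kc r (W \ Y) k := by
  intro S hS u hu v hv
  by_contra hnot
  set Z := (W \ Y) \ S with hZ
  have hZm : ∀ {x}, x ∈ Z ↔ (x ∈ W ∧ x ∉ Y) ∧ x ∉ S := by intro x; simp [hZ]
  set A := Z.filter fun x => ¬ Rch r Z u x with hA
  set B := Z.filter fun x => Rch r Z u x with hB
  have hBA : ∀ b ∈ B, ∀ a ∈ A, ¬ r b a := by
    intro b hb a ha hba
    rw [hA, mem_filter] at ha
    rw [hB, mem_filter] at hb
    exact ha.2 (hb.2.trans (Rch.edge hb.1 ha.1 hba))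
  have hAB : ∀ b ∈ B, ∀ a ∈ A, r a b := by
    intro b hb a ha
    refine hs.of_not ?_ (hBA b hb a ha)
    rintro rfl
    rw [hA, mem_filter] at ha
    rw [hB, mem_filter] at hb
    exact ha.2 hb.2
  have huB : u ∈ B := by rw [hB, mem_filter]; exact ⟨hu, ReflTransGen.refl⟩
  have hvA : v ∈ A := by rw [hA, mem_filter]; exact ⟨hv, hnot⟩
  have hcase : ∃ j : ℕ, ∃ Low : Finset V, Low ⊆ Y ∧
      (∀ y ∈ Low, ∀ a ∈ A, ¬ r y a) ∧
      ∀ y ∈ Y, y ∉ Low → j ≤ f y ∧ (∀ z ∈ Low, f z ≤ j) ∧ ∀ b ∈ B, r b y → f y ≤ j + 3 := by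
    by_cases hEx : ∃ y ∈ Y, ∃ a ∈ A, r y a
    · obtain ⟨y₀, hy₀, hmin⟩ := exists_min_image (Y.filter fun y => ∃ a ∈ A, r y a) f
        (by obtain ⟨y, hy, h⟩ := hEx; exact ⟨y, mem_filter.2 ⟨hy, h⟩⟩)
      obtain ⟨hy₀, a, ha, hya⟩ := mem_filter.1 hy₀
      refine ⟨f y₀, Y.filter fun y => f y < f y₀, filter_subset _ _, ?_, ?_⟩
      · intro y hy a ha hya
        rw [mem_filter] at hy
        have := hmin y (mem_filter.2 ⟨hy.1, a, ha, hya⟩)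
        omega
      · intro y hy hyl
        refine ⟨by by_contra hc; exact hyl (mem_filter.2 ⟨hy, by omega⟩),
          fun z hz => (mem_filter.1 hz).2.le, fun b hb hby => ?_⟩
        have haW := (hZm.1 (mem_filter.1 ha).1).1.1
        have hbW := (hZm.1 (mem_filter.1 hb).1).1.1
        have h1 := hf y₀ (hY hy₀) a haW hya
        have h2 := hf a haW b hbW (hAB b hb a ha)
        have h3 := hf b hbW y (hY hy) hby
        omega
    · push Not at hEx
      exact ⟨0, Y, subset_rfl, hEx, fun y hy hn => absurd hy hn⟩
  obtain ⟨j, Low, hLow, hLA, hrest⟩ := hcase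
  set Rem := Y.filter fun y => y ∉ Low ∧ f y ≤ j + 3 with hRem
  have hRc : Rem.card ≤ 4 := by
    have : Rem.card ≤ (Icc j (j + 3)).card := by
      refine card_le_card_of_injOn f ?_ ?_
      · intro y hy
        have hy' := mem_filter.1 (mem_coe.1 hy)
        simp only [coe_Icc, Set.mem_Icc]
        exact ⟨(hrest y hy'.1 hy'.2.1).1, hy'.2.2⟩
      · exact hinj.mono (by intro y hy; exact (mem_filter.1 (mem_coe.1 hy)).1)
    rw [Nat.card_Icc] at this; omega
  have hstr := h (S ∪ Rem) ((card_union_le _ _).trans_lt (by omega))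
  have hmem : ∀ x ∈ Z, x ∈ W \ (S ∪ Rem) := by
    intro x hx
    have := hZm.1 hx
    simp only [mem_sdiff, mem_union, not_or]
    exact ⟨this.1.1, this.2, fun hr => this.1.2 (mem_filter.1 hr).1⟩
  have hcl := Rch.closed (C := fun x => x ∈ B ∨ x ∈ Low) ?_
    (hstr u (hmem u hu) v (hmem v hv)) (Or.inl huB)
  · rcases hcl with hc | hc
    · exact hnot (mem_filter.1 hc).2
    · exact (hZm.1 hv).1.2 (hLow hc)
  · intro a b ha hab haS hbS
    simp only [mem_sdiff, mem_union, not_or] at hbS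
    by_cases hbY : b ∈ Y
    · by_cases hbl : b ∈ Low
      · exact Or.inr hbl
      · exfalso
        have hb4 : ¬ f b ≤ j + 3 := fun hc => hbS.2.2 (mem_filter.2 ⟨hbY, hbl, hc⟩)
        rcases ha with ha | ha
        · exact hb4 ((hrest b hbY hbl).2.2 a ha hab)
        · have h1 := hf a (hY (hLow ha)) b hbS.1 hab
          have h2 := (hrest b hbY hbl).2.1 a ha
          omega
    · left
      have hbZ : b ∈ Z := hZm.2 ⟨⟨hbS.1, hbY⟩, hbS.2.1⟩
      by_contra hbB
      have hbA : b ∈ A := mem_filter.2 ⟨hbZ, fun hr => hbB (mem_filter.2 ⟨hbZ, hr⟩)⟩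
      rcases ha with ha | ha
      · exact hBA a ha b hbA hab
      · exact hLA a ha b hbA hab

/-- Vertices of `Z` at distance at most `i` from `Start`. -/
def lev (r : V → V → Prop) (Start Z : Finset V) : ℕ → Finset V
  | 0 => Start
  | i + 1 => lev r Start Z i ∪ Z.filter fun v => ∃ u ∈ lev r Start Z i, r u v

theorem exists_levels {Start Z : Finset V} (hSZ : Start ⊆ Z)
    (hreach : ∀ v ∈ Z, ∃ s ∈ Start, Rch r Z s v) :
    ∃ f : V → ℕ, (∀ v ∈ Z, f v = 0 ↔ v ∈ Start) ∧
      (∀ u ∈ Z, ∀ v ∈ Z, r u v → f v ≤ f u + 1) ∧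
      ∀ i, ∀ v ∈ Z, f v = i + 1 → ∃ u ∈ Z, f u = i ∧ r u v := by
  have hlevZ : ∀ i, lev r Start Z i ⊆ Z := by
    intro i
    induction i with
    | zero => exact hSZ
    | succ i ih => exact union_subset ih (filter_subset _ _)
  have hstep : ∀ i, ∀ u ∈ lev r Start Z i, ∀ v ∈ Z, r u v → v ∈ lev r Start Z (i + 1) :=
    fun i u hu v hv huv => mem_union_right _ (mem_filter.2 ⟨hv, u, hu, huv⟩)
  have hex : ∀ v ∈ Z, ∃ i, v ∈ lev r Start Z i := by
    intro v hv
    obtain ⟨s, hs, hsv⟩ := hreach v hv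
    refine Rch.closed (C := fun x => ∃ i, x ∈ lev r Start Z i) ?_ hsv ⟨0, hs⟩
    rintro a b ⟨i, hi⟩ hab _ hb
    exact ⟨i + 1, hstep i a hi b hb hab⟩
  set f : V → ℕ := fun v => if h : ∃ i, v ∈ lev r Start Z i then Nat.find h else 0 with hf
  have hmem : ∀ v ∈ Z, v ∈ lev r Start Z (f v) := by
    intro v hv
    simp only [hf, dif_pos (hex v hv)]
    exact Nat.find_spec (hex v hv)
  have hle : ∀ v i, v ∈ lev r Start Z i → f v ≤ i := by
    intro v i hi
    have : ∃ i, v ∈ lev r Start Z i := ⟨i, hi⟩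
    simp only [hf, dif_pos this]
    exact Nat.find_min' this hi
  refine ⟨f, fun v hv => ⟨fun h => ?_, fun h => ?_⟩, fun u hu v hv huv =>
    hle _ _ (hstep _ u (hmem u hu) v hv huv), fun i v hv hi => ?_⟩
  · have := hmem v hv
    rwa [h] at this
  · exact Nat.le_zero.1 (hle v 0 h)
  · have := hmem v hv
    rw [hi] at this
    rcases mem_union.1 this with h | h
    · have := hle v i h; omega
    · obtain ⟨-, u, hu, huv⟩ := mem_filter.1 h
      refine ⟨u, hlevZ i hu, le_antisymm (hle u i hu) ?_, huv⟩
      by_contra hlt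
      have := hle v _ (hstep _ u (hmem u (hlevZ i hu)) v hv huv)
      omega

theorem exists_level_path {Z : Finset V} {f : V → ℕ}
    (hpred : ∀ i, ∀ v ∈ Z, f v = i + 1 → ∃ u ∈ Z, f u = i ∧ r u v) :
    ∀ m, ∀ b ∈ Z, f b = m → ∃ p : ℕ → V, p m = b ∧ (∀ i ≤ m, p i ∈ Z ∧ f (p i) = i) ∧
      ∀ i < m, r (p i) (p (i + 1)) := by
  intro m
  induction m with
  | zero =>
    intro b hb h0
    refine ⟨fun _ => b, rfl, fun i hi => ?_, fun i hi => absurd hi (by omega)⟩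
    obtain rfl : i = 0 := by omega
    exact ⟨hb, h0⟩
  | succ m ih =>
    intro b hb hm
    obtain ⟨u, hu, hum, hub⟩ := hpred m b hb hm
    obtain ⟨p, hp1, hp2, hp3⟩ := ih u hu hum
    refine ⟨fun i => if i ≤ m then p i else b, by simp, fun i hi => ?_, fun i hi => ?_⟩
    · by_cases h : i ≤ m
      · simpa [h] using hp2 i h
      · obtain rfl : i = m + 1 := by omega
        simp [hb, hm]
    · by_cases h : i + 1 ≤ m
      · simpa [h, show i ≤ m by omega] using hp3 i (by omega)
      · obtain rfl : i = m := by omega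
        simp [hp1, hub]

/-- A shortest path from `Start` to `End` through a highly connected set `W`: it is short, its
removal hardly affects the connectivity, and vertices adjacent to `Start` or `End` have few
neighbours on it. -/
theorem exists_short_path (hs : Semi r) {W Start End : Finset V} {k : ℕ}
    (hW : Kc r W (k + 4)) (hSn : Start.Nonempty) (hEn : End.Nonempty)
    (hSE : Disjoint Start End)
    (hSo : ∀ s ∈ Start, ∃ w ∈ W, r s w) (hEi : ∀ e ∈ End, ∃ w ∈ W, r w e) :
    ∃ (P : Finset V) (a b : V), a ∈ Start ∧ b ∈ End ∧ P ⊆ W ∧ P.card * k ≤ W.card + 2 * k ∧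
      (∀ v ∈ insert a (insert b P), Rch r (insert a (insert b P)) a v ∧
        Rch r (insert a (insert b P)) v b) ∧
      (∀ Y ⊆ P, Kc r (W \ Y) k) ∧
      (∀ v ∈ W, (∃ s ∈ Start, r s v) → (P.filter (r v)).card ≤ 2) ∧
      (∀ v ∈ Start, (P.filter (r v)).card ≤ 1) ∧
      (∀ v ∈ W, (∃ e ∈ End, r v e) → (P.filter fun w => r w v).card ≤ 2) ∧
      ∀ v ∈ End, (P.filter fun w => r w v).card ≤ 1 := by
  have hWs : StrongOn r W := by simpa using hW ∅ (by simp)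
  set Z := W ∪ (Start ∪ End) with hZ
  have hWZ : W ⊆ Z := subset_union_left
  have hSZ : Start ⊆ Z := subset_union_left.trans subset_union_right
  have hEZ : End ⊆ Z := subset_union_right.trans subset_union_right
  obtain ⟨s₀, hs₀⟩ := hSn
  obtain ⟨w₀, hw₀, hsw₀⟩ := hSo s₀ hs₀
  have hreachW : ∀ v ∈ W, Rch r Z s₀ v := fun v hv =>
    (Rch.edge (hSZ hs₀) (hWZ hw₀) hsw₀).trans ((hWs w₀ hw₀ v hv).mono hWZ)
  obtain ⟨f, hf0, hf1, hf2⟩ := exists_levels (r := r) hSZ (by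
    intro v hv
    rcases mem_union.1 hv with hv | hv
    · exact ⟨s₀, hs₀, hreachW v hv⟩
    · rcases mem_union.1 hv with hv | hv
      · exact ⟨v, hv, ReflTransGen.refl⟩
      · obtain ⟨w, hw, hwe⟩ := hEi v hv
        exact ⟨s₀, hs₀, (hreachW w hw).trans (Rch.edge (hWZ hw) (hEZ hv) hwe)⟩)
  obtain ⟨b, hb, hbmin⟩ := exists_min_image End f hEn
  obtain ⟨p, hp1, hp2, hp3⟩ := exists_level_path (r := r) hf2 (f b) b (hEZ hb) rfl
  set m := f b with hm
  have hm0 : 0 < m := by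
    rw [Nat.pos_iff_ne_zero]
    intro h
    exact disjoint_left.1 hSE ((hf0 b (hEZ hb)).1 h) hb
  have hinW : ∀ v ∈ Z, 0 < f v → f v < m → v ∈ W := by
    intro v hv h0 h1
    rcases mem_union.1 hv with hv' | hv'
    · exact hv'
    · rcases mem_union.1 hv' with hv' | hv'
      · have := (hf0 v hv).2 hv'; omega
      · have := hbmin v hv'; omega
  set P := (Ioo 0 m).image p with hP
  have hPmem : ∀ {x}, x ∈ P ↔ ∃ i, (0 < i ∧ i < m) ∧ p i = x := by intro x; simp [hP]
  have hPW : P ⊆ W := by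
    intro x hx
    obtain ⟨i, hi, rfl⟩ := hPmem.1 hx
    have := hp2 i (by omega)
    exact hinW _ this.1 (by omega) (by omega)
  have hfinj : Set.InjOn f P := by
    intro x hx y hy hxy
    obtain ⟨i, hi, rfl⟩ := hPmem.1 (mem_coe.1 hx)
    obtain ⟨j, hj, rfl⟩ := hPmem.1 (mem_coe.1 hy)
    rw [(hp2 i (by omega)).2, (hp2 j (by omega)).2] at hxy
    rw [hxy]
  have hfP : ∀ x ∈ P, 0 < f x ∧ f x < m := by
    intro x hx
    obtain ⟨i, hi, rfl⟩ := hPmem.1 hx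
    rw [(hp2 i (by omega)).2]; exact hi
  have hcardle : ∀ (q : V → Prop) (lo hi : ℕ), (∀ x ∈ P, q x → lo ≤ f x ∧ f x < hi) →
      (P.filter q).card ≤ hi - lo := by
    intro q lo hi h
    rw [← Nat.card_Ico]
    refine card_le_card_of_injOn f ?_ (hfinj.mono ?_)
    · intro x hx
      have := mem_filter.1 (mem_coe.1 hx)
      simpa using h x this.1 this.2
    · intro x hx
      exact (mem_filter.1 (mem_coe.1 hx)).1
  have hlevel : ∀ i, 2 ≤ i → i + 1 < m → k ≤ (W.filter fun v => f v = i).card := by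
    intro i hi him
    by_contra! hlt
    have hst := hW _ (hlt.trans_le (Nat.le_add_right k 4))
    have h1 := hp2 1 (by omega)
    have h2 := hp2 (m - 1) (by omega)
    have hm1 : p 1 ∈ W \ W.filter fun v => f v = i := by
      simp only [mem_sdiff, mem_filter, not_and]
      exact ⟨hinW _ h1.1 (by omega) (by omega), fun _ => by omega⟩
    have hm2 : p (m - 1) ∈ W \ W.filter fun v => f v = i := by
      simp only [mem_sdiff, mem_filter, not_and]
      exact ⟨hinW _ h2.1 (by omega) (by omega), fun _ => by omega⟩
    have := Rch.closed (C := fun x => f x < i) ?_ (hst _ hm1 _ hm2) (by omega)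
    · omega
    · intro x y hx hxy hxS hyS
      simp only [mem_sdiff, mem_filter, not_and] at hxS hyS
      have h3 := hf1 x (hWZ hxS.1) y (hWZ hyS.1) hxy
      have h4 := hyS.2 hyS.1
      omega
  have hlen : (m - 3) * k ≤ W.card := by
    have h1 : ((Ico 2 (m - 1)).biUnion fun i => W.filter fun v => f v = i) ⊆ W := by
      intro x hx
      obtain ⟨i, -, hx⟩ := mem_biUnion.1 hx
      exact (mem_filter.1 hx).1
    have h2 := card_le_card h1
    rw [card_biUnion] at h2
    · have h3 : (Ico 2 (m - 1)).card • k ≤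
          ∑ i ∈ Ico 2 (m - 1), (W.filter fun v => f v = i).card :=
        card_nsmul_le_sum _ _ _ fun i hi => by
          rw [mem_Ico] at hi
          exact hlevel i hi.1 (by omega)
      rw [Nat.card_Ico, smul_eq_mul] at h3
      have : m - 1 - 2 = m - 3 := by omega
      rw [this] at h3; omega
    · intro i _ j _ hij
      rw [Function.onFun, disjoint_left]
      intro x hx hy
      exact hij ((mem_filter.1 hx).2.symm.trans (mem_filter.1 hy).2)
  have hPcard : P.card ≤ m - 1 := by
    refine card_image_le.trans ?_
    simp
  have hall : ∀ i ≤ m, p i ∈ insert (p 0) (insert b P) := by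
    intro i hi
    rcases Nat.eq_zero_or_pos i with rfl | h0
    · simp
    rcases Nat.lt_or_ge i m with h | h
    · exact mem_insert_of_mem (mem_insert_of_mem (hPmem.2 ⟨i, ⟨h0, h⟩, rfl⟩))
    · obtain rfl : i = m := by omega
      simp [hp1]
  have hof : ∀ x ∈ insert (p 0) (insert b P), ∃ i ≤ m, p i = x := by
    intro x hx
    rcases mem_insert.1 hx with rfl | hx
    · exact ⟨0, by omega, rfl⟩
    rcases mem_insert.1 hx with rfl | hx
    · exact ⟨m, le_rfl, hp1⟩
    · obtain ⟨i, hi, h⟩ := hPmem.1 hx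
      exact ⟨i, by omega, h⟩
  have hwalk : ∀ j ≤ m, ∀ i ≤ j, Rch r (insert (p 0) (insert b P)) (p i) (p j) := by
    intro j
    induction j with
    | zero => intro _ i hi; obtain rfl : i = 0 := by omega
              exact ReflTransGen.refl
    | succ j ih =>
      intro hj i hi
      rcases Nat.lt_or_ge i (j + 1) with h | h
      · exact (ih (by omega) i (by omega)).trans
          (Rch.edge (hall j (by omega)) (hall (j + 1) hj) (hp3 j (by omega)))
      · obtain rfl : i = j + 1 := by omega
        exact ReflTransGen.refl
  have h0 := hp2 0 (by omega)
  refine ⟨P, p 0, b, (hf0 _ h0.1).1 h0.2, hb, hPW, ?_, ?_, ?_, ?_, ?_, ?_, ?_⟩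
  · calc P.card * k ≤ ((m - 3) + 2) * k := Nat.mul_le_mul_right _ (by omega)
      _ = (m - 3) * k + 2 * k := by ring
      _ ≤ _ := by omega
  · intro v hv
    obtain ⟨i, hi, rfl⟩ := hof v hv
    exact ⟨hwalk i hi 0 (by omega), by simpa [hp1] using hwalk m le_rfl i hi⟩
  · exact fun Y hY => hW.sdiff_levels hs f (fun u hu v hv huv => hf1 u (hWZ hu) v (hWZ hv) huv)
      (hY.trans hPW) (hfinj.mono (by exact_mod_cast hY))
  · rintro v hv ⟨s, hsS, hsv⟩
    refine hcardle _ 1 3 fun x hx hvx => ?_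
    have h1 := hf1 s (hSZ hsS) v (hWZ hv) hsv
    have h2 := hf1 v (hWZ hv) x (hWZ (hPW hx)) hvx
    have h3 := (hf0 s (hSZ hsS)).2 hsS
    have h4 := hfP x hx
    omega
  · intro v hv
    refine hcardle _ 1 2 fun x hx hvx => ?_
    have h2 := hf1 v (hSZ hv) x (hWZ (hPW hx)) hvx
    have h3 := (hf0 v (hSZ hv)).2 hv
    have h4 := hfP x hx
    omega
  · rintro v hv ⟨e, he, hve⟩
    refine (hcardle _ (m - 2) m fun x hx hxv => ?_).trans (by omega)
    have h1 := hf1 v (hWZ hv) e (hEZ he) hve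
    have h2 := hf1 x (hWZ (hPW hx)) v (hWZ hv) hxv
    have h3 := hbmin e he
    have h4 := hfP x hx
    omega
  · intro v hv
    refine (hcardle _ (m - 1) m fun x hx hxv => ?_).trans (by omega)
    have h2 := hf1 x (hWZ (hPW hx)) v (hEZ hv) hxv
    have h3 := hbmin v hv
    have h4 := hfP x hx
    omega

end

noncomputable section

variable {V : Type} {r : V → V → Prop}

/-- Greedy choice of pairwise disjoint small sets. -/
theorem exists_greedy {ι α : Type} (q : ι → Finset α → Finset α → Prop)
    (hq : ∀ i Y F F', F ⊆ F' → q i Y F → q i Y F') (m : ι → ℕ) (F₀ : Finset α) (s : Finset ι)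
    (h : ∀ i ∈ s, ∀ F, F₀ ⊆ F → F.card ≤ F₀.card + ∑ j ∈ s, m j →
      ∃ Y, Disjoint Y F ∧ Y.card ≤ m i ∧ q i Y F) :
    ∃ Y : ι → Finset α,
      (∀ i ∈ s, Disjoint (Y i) F₀ ∧ (Y i).card ≤ m i ∧ q i (Y i) (F₀ ∪ s.biUnion Y)) ∧
      ∀ i ∈ s, ∀ j ∈ s, i ≠ j → Disjoint (Y i) (Y j) := by
  induction s using Finset.induction_on with
  | empty => exact ⟨fun _ => ∅, by simp, by simp⟩
  | insert a s ha ih =>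
    obtain ⟨Y, hY1, hY2⟩ := ih fun i hi F hF hFc => h i (mem_insert_of_mem hi) F hF
      (hFc.trans (by rw [sum_insert ha]; omega))
    obtain ⟨Z, hZd, hZc, hZq⟩ := h a (mem_insert_self _ _) (F₀ ∪ s.biUnion Y) subset_union_left (by
      refine (card_union_le _ _).trans ?_
      have h1 : (s.biUnion Y).card ≤ ∑ j ∈ s, m j :=
        card_biUnion_le.trans (sum_le_sum fun i hi => (hY1 i hi).2.1)
      rw [sum_insert ha]; omega)
    have hne : ∀ i ∈ s, i ≠ a := fun i hi hia => ha (hia ▸ hi)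
    have hb : (insert a s).biUnion (Function.update Y a Z) = Z ∪ s.biUnion Y := by
      rw [biUnion_insert, Function.update_self]
      congr 1
      exact biUnion_congr rfl fun i hi => Function.update_of_ne (hne i hi) _ _
    have hsub : F₀ ∪ s.biUnion Y ⊆ F₀ ∪ (insert a s).biUnion (Function.update Y a Z) := by
      rw [hb]; exact union_subset_union subset_rfl subset_union_right
    have hdis : ∀ i ∈ s, Disjoint Z (Y i) := fun i hi =>
      hZd.mono_right ((subset_biUnion_of_mem Y hi).trans subset_union_right)
    refine ⟨Function.update Y a Z, fun i hi => ?_, fun i hi j hj hij => ?_⟩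
    · rcases mem_insert.1 hi with rfl | hi
      · rw [Function.update_self]
        exact ⟨hZd.mono_right subset_union_left, hZc, hq _ _ _ _ hsub hZq⟩
      · rw [Function.update_of_ne (hne i hi)]
        exact ⟨(hY1 i hi).1, (hY1 i hi).2.1, hq _ _ _ _ hsub (hY1 i hi).2.2⟩
    · rcases mem_insert.1 hi with rfl | hi' <;> rcases mem_insert.1 hj with rfl | hj'
      · exact absurd rfl hij
      · rw [Function.update_self, Function.update_of_ne (hne j hj')]
        exact hdis j hj'
      · rw [Function.update_self, Function.update_of_ne (hne i hi')]
        exact (hdis i hi').symm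
      · rw [Function.update_of_ne (hne i hi'), Function.update_of_ne (hne j hj')]
        exact hY2 i hi' j hj' hij

theorem exists_half (hs : Semi r) {B : Finset V} (hB : B.Nonempty) :
    ∃ e ∈ B, 2 * (B.filter fun w => w ≠ e ∧ ¬ r w e).card ≤ B.card := by
  by_contra! hcon
  have h1 : B.card • B.card < ∑ e ∈ B, 2 * (B.filter fun w => w ≠ e ∧ ¬ r w e).card := by
    rw [← sum_const]
    exact sum_lt_sum_of_nonempty hB hcon
  have h2 : ∑ e ∈ B, (B.filter fun w => w ≠ e ∧ ¬ r w e).card =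
      ∑ e ∈ B, (B.filter fun w => e ≠ w ∧ ¬ r e w).card :=
    (sum_card_bipartiteAbove_eq_sum_card_bipartiteBelow
      (s := B) (t := B) (fun e w => e ≠ w ∧ ¬ r e w)).symm
  have h3 : ∀ e ∈ B, (B.filter fun w => w ≠ e ∧ ¬ r w e).card +
      (B.filter fun w => e ≠ w ∧ ¬ r e w).card ≤ B.card := by
    intro e _
    rw [← card_union_of_disjoint]
    · exact card_le_card (union_subset (filter_subset _ _) (filter_subset _ _))
    · rw [disjoint_left]
      intro w hw hw'
      exact (mem_filter.1 hw').2.2 (hs.of_not (mem_filter.1 hw).2.1 (mem_filter.1 hw).2.2)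
  have h4 := sum_le_sum h3
  rw [sum_add_distrib, ← h2, sum_const] at h4
  rw [← mul_sum] at h1
  omega

variable [Fintype V]

/-- A small strong set receiving an edge from all but few vertices. -/
theorem exists_piece (hs : Semi r) [Nonempty V] {F : Finset V}
    (hF : ∀ v, F.card < (outN r v).card) (c : ℕ) :
    ∃ Y : Finset V, Y.Nonempty ∧ Disjoint Y F ∧ StrongOn r Y ∧ Y.card ≤ c + 3 ∧
      ∀ v ∉ F, 2 ^ c * ((univ.filter fun w => w ∉ F ∧ w ∉ Y ∧ ∀ a ∈ Y, ¬ r w a).card) ≤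
        (outN r v).card := by
  have hWn : (univ \ F).Nonempty := by
    obtain ⟨v⟩ := ‹Nonempty V›
    have := hF v
    have h2 : (outN r v \ F).Nonempty := by
      rw [← card_pos]
      have := le_card_sdiff F (outN r v)
      omega
    obtain ⟨w, hw⟩ := h2
    exact ⟨w, by simpa using (mem_sdiff.1 hw).2⟩
  obtain ⟨a₁, ha₁, hmin⟩ := exists_min_image (univ \ F) (fun v => (outN r v \ F).card) hWn
  have ha₁F : a₁ ∉ F := by simpa using ha₁
  set d := (outN r a₁ \ F).card with hd
  have hdv : ∀ v ∉ F, d ≤ (outN r v).card := fun v hv =>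
    (hmin v (by simpa using hv)).trans (card_le_card sdiff_subset)
  let Bad : Finset V → Finset V := fun Y => univ.filter fun w => w ∉ F ∧ w ∉ Y ∧ ∀ a ∈ Y, ¬ r w a
  have hBm : ∀ {Y w}, w ∈ Bad Y ↔ w ∉ F ∧ w ∉ Y ∧ ∀ a ∈ Y, ¬ r w a := by
    intro Y w; simp [Bad]
  have hBd : (Bad {a₁}).card ≤ d := by
    refine card_le_card fun w hw => ?_
    obtain ⟨h1, h2, h3⟩ := hBm.1 hw
    simp only [mem_sdiff, mem_outN]
    simp only [mem_singleton] at h2 h3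
    exact ⟨hs.of_not h2 (h3 a₁ rfl), h1⟩
  by_cases hem : Bad {a₁} = ∅
  · refine ⟨{a₁}, by simp, by simpa using ha₁F, ?_, by simp, fun v hv => ?_⟩
    · intro u hu v hv
      rw [mem_singleton] at hu hv
      subst hu; subst hv; exact ReflTransGen.refl
    · change 2 ^ c * (Bad {a₁}).card ≤ _
      rw [hem]; simp
  have hiter : ∀ i : ℕ, ∃ (Y : Finset V) (z : V), a₁ ∈ Y ∧ z ∈ Y ∧ z ≠ a₁ ∧ ¬ r z a₁ ∧
      Disjoint Y F ∧ Y.card ≤ i + 2 ∧ (∀ a ∈ Y, a = z ∨ r a z) ∧ (∀ a ∈ Y, a = a₁ ∨ r a₁ a) ∧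
      2 ^ i * (Bad Y).card ≤ d := by
    intro i
    induction i with
    | zero =>
      obtain ⟨z, hz⟩ := nonempty_iff_ne_empty.2 hem
      obtain ⟨h1, h2, h3⟩ := hBm.1 hz
      simp only [mem_singleton] at h2 h3
      have h3 := h3 a₁ rfl
      have h4 := hs.of_not h2 h3
      refine ⟨{a₁, z}, z, by simp, by simp, h2, h3, ?_, card_le_two, ?_, ?_, ?_⟩
      · simp [ha₁F, h1]
      · simp [h4]
      · simp [h4]
      · rw [pow_zero, one_mul]
        refine (card_le_card fun w hw => ?_).trans hBd
        obtain ⟨h1, h2, h3⟩ := hBm.1 hw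
        exact hBm.2 ⟨h1, fun h => h2 (by simp at h; simp [h]),
          fun a ha => h3 a (by simp at ha; simp [ha])⟩
    | succ i ih =>
      obtain ⟨Y, z, h1, h2, h3, h4, h5, h6, h7, h8, h9⟩ := ih
      by_cases hBe : Bad Y = ∅
      · exact ⟨Y, z, h1, h2, h3, h4, h5, by omega, h7, h8, by rw [hBe]; simp⟩
      obtain ⟨e, he, hhalf⟩ := exists_half hs (nonempty_iff_ne_empty.2 hBe)
      obtain ⟨he1, he2, he3⟩ := hBm.1 he
      have hne : ∀ a ∈ Y, e ≠ a := fun a ha hea => he2 (hea ▸ ha)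
      have hto : ∀ a ∈ Y, r a e := fun a ha => hs.of_not (hne a ha) (he3 a ha)
      refine ⟨insert e Y, e, mem_insert_of_mem h1, mem_insert_self _ _, hne _ h1, he3 _ h1, ?_,
        (card_insert_le _ _).trans (by omega), ?_, ?_, ?_⟩
      · rw [disjoint_insert_left]; exact ⟨he1, h5⟩
      · intro a ha
        exact (mem_insert.1 ha).imp id (hto a)
      · intro a ha
        rcases mem_insert.1 ha with rfl | ha
        · exact Or.inr (hto _ h1)
        · exact h8 a ha
      · have hsub : Bad (insert e Y) ⊆ (Bad Y).filter fun w => w ≠ e ∧ ¬ r w e := by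
          intro w hw
          obtain ⟨hw1, hw2, hw3⟩ := hBm.1 hw
          rw [mem_insert, not_or] at hw2
          exact mem_filter.2 ⟨hBm.2 ⟨hw1, hw2.2, fun a ha => hw3 a (mem_insert_of_mem ha)⟩,
            hw2.1, hw3 e (mem_insert_self _ _)⟩
        have h10 := card_le_card hsub
        calc 2 ^ (i + 1) * (Bad (insert e Y)).card = 2 ^ i * (2 * (Bad (insert e Y)).card) := by
              ring
          _ ≤ 2 ^ i * (Bad Y).card := Nat.mul_le_mul_left _ (by omega)
          _ ≤ d := h9
  obtain ⟨Y, z, h1, h2, h3, h4, h5, h6, h7, h8, h9⟩ := hiter c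
  have hzF : z ∉ F := disjoint_left.1 h5 h2
  have : ∃ y ∈ outN r z \ F, y ∉ outN r a₁ \ F := by
    by_contra! hall
    have hss : outN r z \ F ⊂ outN r a₁ \ F := by
      refine (ssubset_iff_of_subset hall).2 ⟨z, ?_, ?_⟩
      · simp [hzF, (h8 z h2).resolve_left h3]
      · simp [hs.1]
    have := card_lt_card hss
    have := hmin z (by simpa using hzF)
    omega
  obtain ⟨y, hy1, hy2⟩ := this
  simp only [mem_sdiff, mem_outN] at hy1 hy2
  have hya : y ≠ a₁ := by rintro rfl; exact h4 hy1.1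
  have hyr : r y a₁ := by
    refine hs.of_not (Ne.symm hya) fun h => hy2 ⟨h, hy1.2⟩
  refine ⟨insert y Y, ⟨y, by simp⟩, ?_, ?_, (card_insert_le _ _).trans (by omega), fun v hv => ?_⟩
  · rw [disjoint_insert_left]; exact ⟨hy1.2, h5⟩
  · have m : ∀ {a}, a ∈ Y → a ∈ insert y Y := fun h => mem_insert_of_mem h
    have hy : y ∈ insert y Y := mem_insert_self _ _
    have hza : Rch r (insert y Y) z a₁ := (Rch.edge (m h2) hy hy1.1).trans
      (Rch.edge hy (m h1) hyr)
    refine strongOn_of_hub a₁ (fun v hv => ?_) fun v hv => ?_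
    · have key : ∀ v ∈ Y, Rch r (insert y Y) a₁ v := fun v hv => by
        rcases h8 v hv with rfl | h
        · exact ReflTransGen.refl
        · exact Rch.edge (m h1) (m hv) h
      rcases mem_insert.1 hv with rfl | hv
      · exact (key z h2).trans (Rch.edge (m h2) hy hy1.1)
      · exact key v hv
    · rcases mem_insert.1 hv with rfl | hv
      · exact Rch.edge hy (m h1) hyr
      · rcases h7 v hv with rfl | h
        · exact hza
        · exact (Rch.edge (m hv) (m h2) h).trans hza
  · refine le_trans (Nat.mul_le_mul_left _ (card_le_card fun w hw => ?_)) (h9.trans (hdv v hv))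
    obtain ⟨hw1, hw2, hw3⟩ := hBm.1 hw
    exact hBm.2 ⟨hw1, fun h => hw2 (mem_insert_of_mem h), fun a ha =>
      hw3 a (mem_insert_of_mem ha)⟩

end

noncomputable section

variable {V : Type} {r : V → V → Prop}

/-- Inside `Y`, every vertex reaches a vertex with `P` and is reached from a vertex with `Q`. -/
def Abs (r : V → V → Prop) (Y : Finset V) (P Q : V → Prop) : Prop :=
  ∀ z ∈ Y, (∃ a ∈ Y, P a ∧ Rch r Y z a) ∧ ∃ b ∈ Y, Q b ∧ Rch r Y b z

theorem Abs.swap {Y : Finset V} {P Q : V → Prop} (h : Abs r Y P Q) :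
    Abs (Function.swap r) Y Q P := fun z hz =>
  ⟨(h z hz).2.imp fun _ hb => ⟨hb.1, hb.2.1, rch_swap.2 hb.2.2⟩,
    (h z hz).1.imp fun _ hb => ⟨hb.1, hb.2.1, rch_swap.2 hb.2.2⟩⟩

theorem Abs.imp {Y : Finset V} {P Q P' Q' : V → Prop} (h : Abs r Y P Q)
    (hP : ∀ v ∈ Y, P v → P' v) (hQ : ∀ v ∈ Y, Q v → Q' v) : Abs r Y P' Q' := fun z hz =>
  ⟨(h z hz).1.imp fun _ hb => ⟨hb.1, hP _ hb.1 hb.2.1, hb.2.2⟩,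
    (h z hz).2.imp fun _ hb => ⟨hb.1, hQ _ hb.1 hb.2.1, hb.2.2⟩⟩

theorem abs_biUnion {ι : Type} {s : Finset ι} {Y : ι → Finset V} {P Q : V → Prop}
    (h : ∀ i ∈ s, Abs r (Y i) P Q) : Abs r (s.biUnion Y) P Q := by
  intro z hz
  obtain ⟨i, hi, hz⟩ := mem_biUnion.1 hz
  have hsub := subset_biUnion_of_mem Y hi
  obtain ⟨⟨a, ha, hPa, hra⟩, b, hb, hQb, hrb⟩ := h i hi z hz
  exact ⟨⟨a, hsub ha, hPa, hra.mono hsub⟩, b, hsub hb, hQb, hrb.mono hsub⟩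

theorem Abs.union {Y Z : Finset V} {P Q : V → Prop} (hY : Abs r Y P Q) (hZ : Abs r Z P Q) :
    Abs r (Y ∪ Z) P Q := by
  intro z hz
  rcases mem_union.1 hz with hz | hz
  · obtain ⟨⟨a, ha, hPa, hra⟩, b, hb, hQb, hrb⟩ := hY z hz
    exact ⟨⟨a, subset_union_left ha, hPa, hra.mono subset_union_left⟩,
      b, subset_union_left hb, hQb, hrb.mono subset_union_left⟩
  · obtain ⟨⟨a, ha, hPa, hra⟩, b, hb, hQb, hrb⟩ := hZ z hz
    exact ⟨⟨a, subset_union_right ha, hPa, hra.mono subset_union_right⟩,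
      b, subset_union_right hb, hQb, hrb.mono subset_union_right⟩

theorem Abs.union_strong {A Y : Finset V} {y : V} {P Q : V → Prop} (hA : StrongOn r A)
    (hy : y ∈ A) (h : Abs r (insert y Y) P Q) : Abs r (A ∪ Y) P Q := by
  have hsub : insert y Y ⊆ A ∪ Y := insert_subset (subset_union_left hy) subset_union_right
  have key : ∀ z ∈ A ∪ Y, ∃ z' ∈ insert y Y, Rch r (A ∪ Y) z z' ∧ Rch r (A ∪ Y) z' z := by
    intro z hz
    rcases mem_union.1 hz with hz | hz
    · exact ⟨y, mem_insert_self _ _, (hA z hz y hy).mono subset_union_left,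
        (hA y hy z hz).mono subset_union_left⟩
    · exact ⟨z, mem_insert_of_mem hz, ReflTransGen.refl, ReflTransGen.refl⟩
  intro z hz
  obtain ⟨z', hz', h1, h2⟩ := key z hz
  obtain ⟨⟨a, ha, hPa, hra⟩, b, hb, hQb, hrb⟩ := h z' hz'
  exact ⟨⟨a, hsub ha, hPa, h1.trans (hra.mono hsub)⟩, b, hsub hb, hQb, (hrb.mono hsub).trans h2⟩

/-- Closing up an almost strong set with an absorbable set. -/
theorem strongOn_union_of_abs {S Y : Finset V} {P Q : V → Prop} {p q : V}
    (hq : q ∈ S) (hpq : ∀ v ∈ S, Rch r S p v ∧ Rch r S v q) (hYn : Y.Nonempty)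
    (hY : Abs r Y P Q) (hP : ∀ a ∈ Y, P a → ∃ s ∈ S, r a s ∧ Rch r S s p)
    (hQ : ∀ b ∈ Y, Q b → ∃ s ∈ S, r s b ∧ Rch r S q s) : StrongOn r (S ∪ Y) := by
  have hl : S ⊆ S ∪ Y := subset_union_left
  have hr : Y ⊆ S ∪ Y := subset_union_right
  have hout : ∀ z ∈ Y, Rch r (S ∪ Y) z p := by
    intro z hz
    obtain ⟨⟨a, ha, hPa, hra⟩, -⟩ := hY z hz
    obtain ⟨s, hs, has, hsp⟩ := hP a ha hPa
    exact (hra.mono hr).trans ((Rch.edge (hr ha) (hl hs) has).trans (hsp.mono hl))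
  have hin : ∀ z ∈ Y, Rch r (S ∪ Y) q z := by
    intro z hz
    obtain ⟨-, b, hb, hQb, hrb⟩ := hY z hz
    obtain ⟨s, hs, hsb, hqs⟩ := hQ b hb hQb
    exact (hqs.mono hl).trans ((Rch.edge (hl hs) (hr hb) hsb).trans (hrb.mono hr))
  obtain ⟨y, hy⟩ := hYn
  have hqp : Rch r (S ∪ Y) q p := (hin y hy).trans (hout y hy)
  refine strongOn_of_hub p (fun v hv => ?_) fun v hv => ?_
  · rcases mem_union.1 hv with hv | hv
    · exact (hpq v hv).1.mono hl
    · exact ((hpq q hq).1.mono hl).trans (hin v hv)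
  · rcases mem_union.1 hv with hv | hv
    · exact ((hpq v hv).2.mono hl).trans hqp
    · exact hout v hv

theorem StrongOn.union_abs {S Y : Finset V} {P Q : V → Prop} (hS : StrongOn r S)
    (hSn : S.Nonempty) (hY : Abs r Y P Q) (hP : ∀ a ∈ Y, P a → ∃ s ∈ S, r a s)
    (hQ : ∀ b ∈ Y, Q b → ∃ s ∈ S, r s b) : StrongOn r (S ∪ Y) := by
  rcases Y.eq_empty_or_nonempty with rfl | hYn
  · simpa using hS
  obtain ⟨c, hc⟩ := hSn
  refine strongOn_union_of_abs hc (fun v hv => ⟨hS c hc v hv, hS v hv c hc⟩) hYn hY ?_ ?_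
  · intro a ha hPa
    obtain ⟨s, hs, h⟩ := hP a ha hPa
    exact ⟨s, hs, h, hS s hs c hc⟩
  · intro a ha hPa
    obtain ⟨s, hs, h⟩ := hQ a ha hPa
    exact ⟨s, hs, h, hS c hc s hs⟩

/-- A six-vertex set absorbable with or without a given vertex. -/
theorem exists_unit {F : Finset V} {P Q : V → Prop} {y : V}
    (hP : ∀ u ∉ F, ∃ a ∉ F, r u a ∧ P a) (hQ : ∀ u ∉ F, ∃ b ∉ F, r b u ∧ Q b)
    (hyo : ∃ u ∉ F, r y u) (hyi : ∃ w ∉ F, r w y) :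
    ∃ Y : Finset V, Y.Nonempty ∧ Y.card ≤ 6 ∧ Disjoint Y F ∧ Abs r Y P Q ∧
      Abs r (insert y Y) P Q := by
  obtain ⟨u, hu, hyu⟩ := hyo
  obtain ⟨w, hw, hwy⟩ := hyi
  obtain ⟨u₁, hu₁, huu₁, hPu⟩ := hP u hu
  obtain ⟨u₂, hu₂, huu₂, hQu⟩ := hQ u hu
  obtain ⟨w₁, hw₁, hww₁, hQw⟩ := hQ w hw
  obtain ⟨w₂, hw₂, hww₂, hPw⟩ := hP w hw
  have h3 : ∀ a b c : V, r a b → r b c → Q a → P c → Abs r {a, b, c} P Q := by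
    intro a b c hab hbc hQ hP
    have e1 : Rch r {a, b, c} a b := Rch.edge (by simp) (by simp) hab
    have e2 : Rch r {a, b, c} b c := Rch.edge (by simp) (by simp) hbc
    have e0 : ∀ v, Rch r {a, b, c} v v := fun v => ReflTransGen.refl
    intro z hz
    simp only [mem_insert, mem_singleton] at hz
    refine ⟨⟨c, by simp, hP, ?_⟩, a, by simp, hQ, ?_⟩
    · rcases hz with rfl | rfl | rfl
      exacts [e1.trans e2, e2, e0 _]
    · rcases hz with rfl | rfl | rfl
      exacts [e0 _, e1, e1.trans e2]
  have hY : Abs r ({u₂, u, u₁} ∪ {w₁, w, w₂}) P Q :=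
    (h3 _ _ _ huu₂ huu₁ hQu hPu).union (h3 _ _ _ hww₁ hww₂ hQw hPw)
  refine ⟨{u₂, u, u₁} ∪ {w₁, w, w₂}, ⟨u, by simp⟩, ?_, ?_, hY, ?_⟩
  · refine (card_union_le _ _).trans ?_
    have h1 : ({u₂, u, u₁} : Finset V).card ≤ 3 := card_le_three
    have h2 : ({w₁, w, w₂} : Finset V).card ≤ 3 := card_le_three
    omega
  · rw [disjoint_left]
    intro a ha
    simp only [mem_union, mem_insert, mem_singleton] at ha
    rcases ha with (rfl | rfl | rfl) | (rfl | rfl | rfl) <;> assumption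
  · intro z hz
    rcases mem_insert.1 hz with rfl | hz
    · refine ⟨⟨u₁, by simp, hPu, ?_⟩, w₁, by simp, hQw, ?_⟩
      · exact (Rch.edge (by simp) (by simp) hyu).trans (Rch.edge (by simp) (by simp) huu₁)
      · exact (Rch.edge (by simp) (by simp) hww₁).trans (Rch.edge (by simp) (by simp) hwy)
    · obtain ⟨⟨a, ha, hPa, hra⟩, b, hb, hQb, hrb⟩ := hY z hz
      have hsub := subset_insert y ({u₂, u, u₁} ∪ {w₁, w, w₂})
      exact ⟨⟨a, hsub ha, hPa, hra.mono hsub⟩, b, hsub hb, hQb, hrb.mono hsub⟩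

end

noncomputable section

variable {V : Type} {r : V → V → Prop} {t : ℕ} {ℓ : Fin t → ℕ} {x : Fin t → V}

/-- Disjoint strong sets `S j ∋ x j` of size at most `ℓ j`. -/
structure Valid (r : V → V → Prop) (ℓ : Fin t → ℕ) (x : Fin t → V) (S : Fin t → Finset V) :
    Prop where
  mem : ∀ j, x j ∈ S j
  strong : ∀ j, StrongOn r (S j)
  le : ∀ j, (S j).card ≤ ℓ j
  disj : ∀ i j, i ≠ j → Disjoint (S i) (S j)

/-- The total length of the indices `j` such that `v` sends no edge to `S j`. -/
def defect (r : V → V → Prop) (ℓ : Fin t → ℕ) (S : Fin t → Finset V) (v : V) : ℕ :=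
  ∑ j ∈ univ.filter fun j => ∀ s ∈ S j, ¬ r v s, ℓ j

/-- `v` sends edges to almost all the sets `S j`, weighted by length. -/
def Fit (r : V → V → Prop) (ℓ : Fin t → ℕ) (S : Fin t → Finset V) (v : V) : Prop :=
  1000 * defect r ℓ S v ≤ ∑ j, ℓ j

theorem Valid.swap {S : Fin t → Finset V} (h : Valid r ℓ x S) :
    Valid (Function.swap r) ℓ x S :=
  ⟨h.mem, fun j => strongOn_swap.2 (h.strong j), h.le, h.disj⟩

theorem Valid.card_biUnion {S : Fin t → Finset V} (h : Valid r ℓ x S) :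
    (univ.biUnion S).card = ∑ j, (S j).card :=
  Finset.card_biUnion fun i _ j _ hij => h.disj i j hij

theorem sum_defect_le {S₀ : Fin t → Finset V} {Y : Finset V} (hY : Y.card ≤ 9) :
    1000 * ∑ a ∈ Y.filter (Fit r ℓ S₀), defect r ℓ S₀ a ≤ 9 * ∑ j, ℓ j := by
  rw [mul_sum]
  calc ∑ a ∈ Y.filter (Fit r ℓ S₀), 1000 * defect r ℓ S₀ a
      ≤ (Y.filter (Fit r ℓ S₀)).card • ∑ j, ℓ j :=
        sum_le_card_nsmul _ _ _ fun a ha => (mem_filter.1 ha).2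
    _ ≤ _ := by
      rw [smul_eq_mul]
      exact Nat.mul_le_mul_right _ ((card_filter_le _ _).trans hY)

theorem Valid.absorb {S₀ S : Fin t → Finset V} (h : Valid r ℓ x S) (hS : ∀ j, S₀ j ⊆ S j)
    (hn : 0 < ∑ j, ℓ j) (ht : 1000 * t ≤ ∑ j, ℓ j)
    (hsz : 4 * (univ.biUnion S).card ≤ ∑ j, ℓ j) {Y : Finset V} (hYc : Y.card ≤ 9)
    (hYS : Disjoint Y (univ.biUnion S))
    (hY : Abs r Y (Fit r ℓ S₀) (Fit (Function.swap r) ℓ S₀)) :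
    ∃ S', Valid r ℓ x S' ∧ (∀ j, S j ⊆ S' j) ∧ univ.biUnion S' = univ.biUnion S ∪ Y := by
  have hgood : ∃ j, (∀ a ∈ Y, Fit r ℓ S₀ a → ∃ s ∈ S₀ j, r a s) ∧
      (∀ b ∈ Y, Fit (Function.swap r) ℓ S₀ b → ∃ s ∈ S₀ j, r s b) ∧ (S j).card + 9 ≤ ℓ j := by
    by_contra! hcon
    have key : ∀ j, ℓ j ≤ (∑ a ∈ Y.filter (Fit r ℓ S₀),
        if ∀ s ∈ S₀ j, ¬ r a s then ℓ j else 0) +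
        (∑ a ∈ Y.filter (Fit (Function.swap r) ℓ S₀),
        if ∀ s ∈ S₀ j, ¬ Function.swap r a s then ℓ j else 0) + ((S j).card + 8) := by
      intro j
      by_cases h1 : ∀ a ∈ Y, Fit r ℓ S₀ a → ∃ s ∈ S₀ j, r a s
      · by_cases h2 : ∀ b ∈ Y, Fit (Function.swap r) ℓ S₀ b → ∃ s ∈ S₀ j, r s b
        · have := hcon j h1 h2; omega
        · push Not at h2
          obtain ⟨a, ha, haF, has⟩ := h2
          have := single_le_sum (f := fun a => if ∀ s ∈ S₀ j, ¬ Function.swap r a s then ℓ j else 0)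
            (fun _ _ => Nat.zero_le _) (mem_filter.2 ⟨ha, haF⟩)
          simp only [Function.swap] at this ⊢
          rw [if_pos has] at this
          omega
      · push Not at h1
        obtain ⟨a, ha, haF, has⟩ := h1
        have := single_le_sum (f := fun a => if ∀ s ∈ S₀ j, ¬ r a s then ℓ j else 0)
          (fun _ _ => Nat.zero_le _) (mem_filter.2 ⟨ha, haF⟩)
        rw [if_pos has] at this
        omega
    have h1 := sum_le_sum fun j (_ : j ∈ (univ : Finset (Fin t))) => key j
    rw [sum_add_distrib, sum_add_distrib, sum_add_distrib, sum_comm,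
      sum_comm (s := univ) (t := Y.filter (Fit (Function.swap r) ℓ S₀)), ← h.card_biUnion] at h1
    simp only [← sum_filter] at h1
    have h2 := sum_defect_le (r := r) (ℓ := ℓ) (S₀ := S₀) hYc
    have h3 := sum_defect_le (r := Function.swap r) (ℓ := ℓ) (S₀ := S₀) hYc
    simp only [defect] at h2 h3
    simp only [sum_const, card_univ, Fintype.card_fin, smul_eq_mul] at h1
    omega
  obtain ⟨j, h1, h2, h3⟩ := hgood
  have hdj : ∀ i, Disjoint Y (S i) := fun i => hYS.mono_right (subset_biUnion_of_mem S (mem_univ i))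
  refine ⟨Function.update S j (S j ∪ Y), ⟨fun i => ?_, fun i => ?_, fun i => ?_, ?_⟩, fun i => ?_, ?_⟩
  · by_cases hij : i = j
    · subst hij; simp [h.mem]
    · simp [hij, h.mem]
  · by_cases hij : i = j
    · subst hij
      rw [Function.update_self]
      refine (h.strong i).union_abs ⟨_, h.mem i⟩ hY ?_ ?_
      · intro a ha hPa
        obtain ⟨s, hs, has⟩ := h1 a ha hPa
        exact ⟨s, hS i hs, has⟩
      · intro a ha hPa
        obtain ⟨s, hs, has⟩ := h2 a ha hPa
        exact ⟨s, hS i hs, has⟩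
    · simp [hij, h.strong]
  · by_cases hij : i = j
    · subst hij
      rw [Function.update_self]
      have := card_union_le (S i) Y
      omega
    · simp [hij, h.le]
  · intro a b hab
    by_cases ha : a = j
    · subst ha
      rw [Function.update_self, Function.update_of_ne hab.symm, disjoint_union_left]
      exact ⟨h.disj _ _ hab, hdj b⟩
    · by_cases hb : b = j
      · subst hb
        rw [Function.update_self, Function.update_of_ne hab, disjoint_union_right]
        exact ⟨h.disj _ _ hab, (hdj a).symm⟩
      · rw [Function.update_of_ne ha, Function.update_of_ne hb]
        exact h.disj _ _ hab
  · by_cases hij : i = j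
    · subst hij; simp
    · simp [hij]
  · ext v
    simp only [mem_biUnion, mem_univ, true_and, mem_union]
    constructor
    · rintro ⟨i, hi⟩
      by_cases hij : i = j
      · subst hij
        rw [Function.update_self, mem_union] at hi
        exact hi.imp (fun h => ⟨i, h⟩) id
      · rw [Function.update_of_ne hij] at hi
        exact Or.inl ⟨i, hi⟩
    · rintro (⟨i, hi⟩ | hv)
      · refine ⟨i, ?_⟩
        by_cases hij : i = j
        · subst hij
          rw [Function.update_self]; exact mem_union_left _ hi
        · rwa [Function.update_of_ne hij]
      · exact ⟨j, by rw [Function.update_self]; exact mem_union_right _ hv⟩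

/-- Absorbing a family of vertices, each of which comes with a private absorbing set. -/
theorem Valid.absorb_private {S₀ : Fin t → Finset V} (h : Valid r ℓ x S₀)
    (hn : 0 < ∑ j, ℓ j) (ht : 1000 * t ≤ ∑ j, ℓ j) {M : Finset V} {U : V → Finset V}
    (hsz : 4 * ((univ.biUnion S₀).card + 7 * M.card) ≤ ∑ j, ℓ j)
    (hUc : ∀ y ∈ M, (U y).card ≤ 6) (hUS : ∀ y ∈ M, Disjoint (U y) (univ.biUnion S₀))
    (hUM : ∀ y ∈ M, Disjoint (U y) M)
    (hUU : ∀ y ∈ M, ∀ z ∈ M, y ≠ z → Disjoint (U y) (U z))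
    (hU : ∀ y ∈ M, Abs r (U y) (Fit r ℓ S₀) (Fit (Function.swap r) ℓ S₀) ∧
      Abs r (insert y (U y)) (Fit r ℓ S₀) (Fit (Function.swap r) ℓ S₀)) :
    ∃ S, Valid r ℓ x S ∧ (∀ j, S₀ j ⊆ S j) ∧
      univ.biUnion S = univ.biUnion S₀ ∪ (M ∪ M.biUnion U) := by
  suffices H : ∀ s ⊆ M, ∃ S, Valid r ℓ x S ∧ (∀ j, S₀ j ⊆ S j) ∧
      univ.biUnion S = univ.biUnion S₀ ∪ (s ∪ s.biUnion U) from H M subset_rfl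
  intro s
  induction s using Finset.induction_on with
  | empty => exact fun _ => ⟨S₀, h, fun j => subset_rfl, by simp⟩
  | insert y s hys ih =>
    intro hsM
    obtain ⟨S, hS1, hS2, hS3⟩ := ih ((subset_insert _ _).trans hsM)
    have hyM : y ∈ M := hsM (mem_insert_self _ _)
    have hsM' : s ⊆ M := (subset_insert _ _).trans hsM
    have hUd : Disjoint (U y) (univ.biUnion S) := by
      rw [hS3, disjoint_union_right, disjoint_union_right]
      exact ⟨hUS y hyM, (hUM y hyM).mono_right hsM', (disjoint_biUnion_right _ _ _).2
        fun z hz => hUU y hyM z (hsM' hz) (by rintro rfl; exact hys hz)⟩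
    have hsz' : 4 * (univ.biUnion S).card ≤ ∑ j, ℓ j := by
      refine le_trans (Nat.mul_le_mul_left _ ?_) hsz
      rw [hS3]
      have h1 := card_union_le (univ.biUnion S₀) (s ∪ s.biUnion U)
      have h2 := card_union_le s (s.biUnion U)
      have h3 : (s.biUnion U).card ≤ s.card * 6 :=
        card_biUnion_le_card_mul _ _ _ fun z hz => hUc z (hsM' hz)
      have h4 := card_le_card hsM'
      omega
    have hYex : ∃ Y : Finset V, Y.card ≤ 9 ∧ Disjoint Y (univ.biUnion S) ∧
        Abs r Y (Fit r ℓ S₀) (Fit (Function.swap r) ℓ S₀) ∧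
        univ.biUnion S ∪ Y = univ.biUnion S ∪ insert y (U y) := by
      have hc := hUc y hyM
      by_cases hy : y ∈ univ.biUnion S
      · refine ⟨U y, by omega, hUd, (hU y hyM).1, ?_⟩
        rw [union_insert, insert_eq_of_mem (mem_union_left _ hy)]
      · exact ⟨insert y (U y), (card_insert_le _ _).trans (by omega),
          disjoint_insert_left.2 ⟨hy, hUd⟩, (hU y hyM).2, rfl⟩
    obtain ⟨Y, hY1, hY2, hY3, hY4⟩ := hYex
    obtain ⟨S', hS'1, hS'2, hS'3⟩ := hS1.absorb hS2 hn ht hsz' hY1 hY2 hY3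
    refine ⟨S', hS'1, fun j => (hS2 j).trans (hS'2 j), ?_⟩
    rw [hS'3, hY4, hS3, biUnion_insert]
    ext v
    simp only [mem_union, mem_insert]
    tauto

/-- Absorbing vertices with the help of suitable neighbours. -/
theorem Valid.absorb_neighbours {S₀ S : Fin t → Finset V} (h : Valid r ℓ x S)
    (hS : ∀ j, S₀ j ⊆ S j) (hn : 0 < ∑ j, ℓ j) (ht : 1000 * t ≤ ∑ j, ℓ j)
    {Q EA EB : Finset V} (hsz : 4 * ((univ.biUnion S).card + 3 * Q.card) ≤ ∑ j, ℓ j)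
    (hA : ∀ v ∉ univ.biUnion S, v ∉ EA → Fit r ℓ S₀ v)
    (hB : ∀ v ∉ univ.biUnion S, v ∉ EB → Fit (Function.swap r) ℓ S₀ v)
    (hQA : ∀ v ∈ Q, v ∉ univ.biUnion S → v ∈ EA → ∃ N : Finset V, 3 * Q.card < N.card ∧
      ∀ u ∈ N, u ∉ univ.biUnion S ∧ u ∉ EA ∧ r v u)
    (hQB : ∀ v ∈ Q, v ∉ univ.biUnion S → v ∈ EB → ∃ N : Finset V, 3 * Q.card < N.card ∧
      ∀ u ∈ N, u ∉ univ.biUnion S ∧ u ∉ EB ∧ r u v) :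
    ∃ S', Valid r ℓ x S' ∧ (∀ j, S j ⊆ S' j) ∧ univ.biUnion S ⊆ univ.biUnion S' ∧
      Q ⊆ univ.biUnion S' ∧ (univ.biUnion S' \ univ.biUnion S).card ≤ 3 * Q.card := by
  suffices H : ∀ s ⊆ Q, ∃ S', Valid r ℓ x S' ∧ (∀ j, S j ⊆ S' j) ∧
      univ.biUnion S ⊆ univ.biUnion S' ∧
      s ⊆ univ.biUnion S' ∧ (univ.biUnion S' \ univ.biUnion S).card ≤ 3 * s.card from
    H Q subset_rfl
  intro s
  induction s using Finset.induction_on with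
  | empty => exact fun _ => ⟨S, h, fun j => subset_rfl, subset_rfl, by simp, by simp⟩
  | insert v s hvs ih =>
    intro hsQ
    obtain ⟨S', h1, h2, h3, h4, h5⟩ := ih ((subset_insert _ _).trans hsQ)
    have hvQ : v ∈ Q := hsQ (mem_insert_self _ _)
    have hcs : s.card + 1 ≤ Q.card := by
      rw [← card_insert_of_notMem hvs]; exact card_le_card hsQ
    rw [card_insert_of_notMem hvs]
    by_cases hv : v ∈ univ.biUnion S'
    · exact ⟨S', h1, h2, h3, insert_subset hv h4, by omega⟩
    have hv0 : v ∉ univ.biUnion S := fun hh => hv (h3 hh)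
    have pick : ∀ N : Finset V, 3 * Q.card < N.card → (∀ u ∈ N, u ∉ univ.biUnion S) →
        ∃ u ∈ N, u ∉ univ.biUnion S' := by
      intro N hN hNS
      by_contra! hall
      have : N ⊆ univ.biUnion S' \ univ.biUnion S := fun u hu =>
        mem_sdiff.2 ⟨hall u hu, hNS u hu⟩
      have := card_le_card this
      omega
    have hu : ∃ u, u ∉ univ.biUnion S' ∧ Fit r ℓ S₀ u ∧ (v = u ∨ r v u) := by
      by_cases hvA : v ∈ EA
      · obtain ⟨N, hN1, hN2⟩ := hQA v hvQ hv0 hvA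
        obtain ⟨u, hu1, hu2⟩ := pick N hN1 fun u hu => (hN2 u hu).1
        exact ⟨u, hu2, hA u (hN2 u hu1).1 (hN2 u hu1).2.1, Or.inr (hN2 u hu1).2.2⟩
      · exact ⟨v, hv, hA v hv0 hvA, Or.inl rfl⟩
    have hw : ∃ w, w ∉ univ.biUnion S' ∧ Fit (Function.swap r) ℓ S₀ w ∧ (w = v ∨ r w v) := by
      by_cases hvB : v ∈ EB
      · obtain ⟨N, hN1, hN2⟩ := hQB v hvQ hv0 hvB
        obtain ⟨u, hu1, hu2⟩ := pick N hN1 fun u hu => (hN2 u hu).1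
        exact ⟨u, hu2, hB u (hN2 u hu1).1 (hN2 u hu1).2.1, Or.inr (hN2 u hu1).2.2⟩
      · exact ⟨v, hv, hB v hv0 hvB, Or.inl rfl⟩
    obtain ⟨u, hu1, hu2, hu3⟩ := hu
    obtain ⟨w, hw1, hw2, hw3⟩ := hw
    have hc3 : ({w, v, u} : Finset V).card ≤ 3 := card_le_three
    have hwv : Rch r {w, v, u} w v := by
      rcases hw3 with rfl | hw3
      · exact ReflTransGen.refl
      · exact Rch.edge (by simp) (by simp) hw3
    have hvu : Rch r {w, v, u} v u := by
      rcases hu3 with rfl | hu3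
      · exact ReflTransGen.refl
      · exact Rch.edge (by simp) (by simp) hu3
    have hsz' : (univ.biUnion S').card ≤ (univ.biUnion S).card + 3 * Q.card := by
      have := card_sdiff_add_card_eq_card h3
      omega
    obtain ⟨S'', g1, g2, g3⟩ := h1.absorb (S₀ := S₀) (fun j => (hS j).trans (h2 j)) hn ht
      (by omega) (Y := {w, v, u}) (by omega) (by
        rw [disjoint_left]
        intro a ha
        simp only [mem_insert, mem_singleton] at ha
        rcases ha with rfl | rfl | rfl <;> assumption) (by
        intro z hz
        simp only [mem_insert, mem_singleton] at hz
        refine ⟨⟨u, by simp, hu2, ?_⟩, w, by simp, hw2, ?_⟩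
        · rcases hz with rfl | rfl | rfl
          exacts [hwv.trans hvu, hvu, ReflTransGen.refl]
        · rcases hz with rfl | rfl | rfl
          exacts [ReflTransGen.refl, hwv, hwv.trans hvu])
    refine ⟨S'', g1, fun j => (h2 j).trans (g2 j), ?_, ?_, ?_⟩
    · rw [g3]; exact h3.trans subset_union_left
    · rw [g3]
      exact insert_subset (mem_union_right _ (by simp)) (h4.trans subset_union_left)
    · rw [g3, union_sdiff_distrib]
      have h6 := card_union_le (univ.biUnion S' \ univ.biUnion S) ({w, v, u} \ univ.biUnion S)
      have h7 := card_le_card (sdiff_subset (s := {w, v, u}) (t := univ.biUnion S))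
      omega

variable [Fintype V]

/-- Distributing the remaining vertices by Hall's theorem. -/
theorem Valid.distribute {S₀ S : Fin t → Finset V} (h : Valid r ℓ x S)
    (hS : ∀ j, S₀ j ⊆ S j) (hn : ∑ j, ℓ j = Fintype.card V)
    (hsz : 4 * (univ.biUnion S).card ≤ ∑ j, ℓ j)
    (hA : ∀ v ∉ univ.biUnion S, Fit r ℓ S₀ v ∧ Fit (Function.swap r) ℓ S₀ v)
    (hroot : ∀ j, (S j).card < ℓ j →
      16 * (univ.filter fun v => v ∉ univ.biUnion S ∧ ∀ s ∈ S₀ j, ¬ r v s).card ≤ ∑ j, ℓ j ∧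
      16 * (univ.filter fun v => v ∉ univ.biUnion S ∧ ∀ s ∈ S₀ j, ¬ r s v).card ≤ ∑ j, ℓ j) :
    ∃ T : Fin t → Finset V, Valid r ℓ x T ∧ ∀ j, (T j).card = ℓ j := by
  set L := {v : V // v ∉ univ.biUnion S} with hL
  let ok : V → Fin t → Prop := fun v j => (∃ s ∈ S₀ j, r v s) ∧ ∃ s ∈ S₀ j, r s v
  let slots : L → Finset (Σ j : Fin t, Fin (ℓ j - (S j).card)) :=
    fun v => univ.filter fun p => ok v.1 p.1
  have hcap : ∑ j, (ℓ j - (S j).card) + (univ.biUnion S).card = ∑ j, ℓ j := by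
    rw [h.card_biUnion, ← sum_add_distrib]
    exact sum_congr rfl fun j _ => Nat.sub_add_cancel (h.le j)
  have hLc : Fintype.card L + (univ.biUnion S).card = Fintype.card V := by
    have h1 : Fintype.card L = ((univ.biUnion S)ᶜ).card :=
      Fintype.card_of_subtype _ fun v => mem_compl
    rw [h1, card_compl]
    exact Nat.sub_add_cancel (card_le_univ _)
  have hslot : ∀ v : L, (slots v).card = ∑ j ∈ univ.filter (ok v.1), (ℓ j - (S j).card) := by
    intro v
    have : slots v = (univ.filter (ok v.1)).sigma fun _ => univ := by
      ext p; simp [slots]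
    rw [this, card_sigma]
    simp
  have hHall : ∀ X : Finset L, X.card ≤ (X.biUnion slots).card := by
    intro X
    rcases X.eq_empty_or_nonempty with rfl | ⟨v, hv⟩
    · simp
    by_cases hX : 4 * X.card ≤ ∑ j, ℓ j
    · refine le_trans ?_ (card_le_card (subset_biUnion_of_mem slots hv))
      rw [hslot]
      have h1 : ∑ j, (ℓ j - (S j).card) ≤ ∑ j ∈ univ.filter (ok v.1), (ℓ j - (S j).card) +
          (defect r ℓ S₀ v.1 + defect (Function.swap r) ℓ S₀ v.1) := by
        rw [← sum_filter_add_sum_filter_not univ (ok v.1)]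
        refine Nat.add_le_add_left ?_ _
        refine (sum_le_sum fun j _ => Nat.sub_le _ _).trans ?_
        unfold defect
        rw [← sum_union_inter]
        refine (sum_le_sum_of_subset ?_).trans (Nat.le_add_right _ _)
        intro j hj
        have hj := (mem_filter.1 hj).2
        simp only [ok, not_and_or] at hj
        push Not at hj
        simpa [Function.swap] using hj
      have h2 := (hA v.1 v.2).1
      have h3 := (hA v.1 v.2).2
      unfold Fit at h2 h3
      omega
    · have : X.biUnion slots = univ := by
        rw [eq_univ_iff_forall]
        rintro ⟨j, i⟩
        have hj : (S j).card < ℓ j := by have := i.2; omega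
        obtain ⟨hr1, hr2⟩ := hroot j hj
        have hex : ∃ v ∈ X, ok v.1 j := by
          by_contra! hcon
          have hsub : X.map (Function.Embedding.subtype _) ⊆
              (univ.filter fun v => v ∉ univ.biUnion S ∧ ∀ s ∈ S₀ j, ¬ r v s) ∪
              univ.filter fun v => v ∉ univ.biUnion S ∧ ∀ s ∈ S₀ j, ¬ r s v := by
            intro a ha
            obtain ⟨v, hv, rfl⟩ := mem_map.1 ha
            have hj := hcon v hv
            simp only [ok, not_and_or] at hj
            push Not at hj
            rw [mem_union, mem_filter, mem_filter]
            exact hj.imp (fun hj => ⟨mem_univ _, v.2, hj⟩) fun hj => ⟨mem_univ _, v.2, hj⟩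
          have h1 := card_le_card hsub
          rw [card_map] at h1
          have h2 := h1.trans (card_union_le _ _)
          omega
        obtain ⟨v, hv, hvj⟩ := hex
        exact mem_biUnion.2 ⟨v, hv, by simpa [slots] using hvj⟩
      rw [this, card_univ, Fintype.card_sigma]
      simp only [Fintype.card_fin]
      have := card_le_univ X
      omega
  obtain ⟨f, hfi, hfs⟩ := (all_card_le_biUnion_card_iff_exists_injective slots).1 hHall
  have hok : ∀ v : L, ok v.1 (f v).1 := fun v => by
    have := hfs v
    simpa [slots] using this
  let F : Fin t → Finset V := fun j =>
    (univ.filter fun v : L => (f v).1 = j).map (Function.Embedding.subtype _)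
  have hFm : ∀ {j v}, v ∈ F j ↔ ∃ hv : v ∉ univ.biUnion S, (f ⟨v, hv⟩).1 = j := by
    intro j v
    simp only [F, mem_map, mem_filter, mem_univ, true_and, Function.Embedding.subtype_apply]
    constructor
    · rintro ⟨w, hw, rfl⟩; exact ⟨w.2, hw⟩
    · rintro ⟨hv, h⟩; exact ⟨⟨v, hv⟩, h, rfl⟩
  have hFc : ∀ j, (F j).card ≤ ℓ j - (S j).card := by
    intro j
    rw [card_map]
    have : (univ.filter fun v : L => (f v).1 = j).card ≤
        (({j} : Finset (Fin t)).sigma fun j => (univ : Finset (Fin (ℓ j - (S j).card)))).card := by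
      refine card_le_card_of_injOn f ?_ hfi.injOn
      intro v hv
      simpa using hv
    simpa using this
  have hSF : ∀ i j, Disjoint (S i) (F j) := by
    intro i j
    rw [disjoint_left]
    intro v hv hvF
    obtain ⟨hv', -⟩ := hFm.1 hvF
    exact hv' (subset_biUnion_of_mem S (mem_univ i) hv)
  have hFF : ∀ i j, i ≠ j → Disjoint (F i) (F j) := by
    intro i j hij
    rw [disjoint_left]
    intro v hv hv'
    obtain ⟨_, h1⟩ := hFm.1 hv
    obtain ⟨_, h2⟩ := hFm.1 hv'
    exact hij (h1.symm.trans h2)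
  have hT : Valid r ℓ x fun j => S j ∪ F j := by
    refine ⟨fun j => mem_union_left _ (h.mem j), fun j => ?_, fun j => ?_, fun i j hij => ?_⟩
    · refine (h.strong j).union_abs (P := fun _ => True) (Q := fun _ => True) ⟨_, h.mem j⟩
        (fun z hz => ⟨⟨z, hz, trivial, ReflTransGen.refl⟩, z, hz, trivial, ReflTransGen.refl⟩) ?_ ?_
      · intro a ha _
        obtain ⟨hv, rfl⟩ := hFm.1 ha
        obtain ⟨s, hs, has⟩ := (hok ⟨a, hv⟩).1
        exact ⟨s, hS _ hs, has⟩
      · intro a ha _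
        obtain ⟨hv, rfl⟩ := hFm.1 ha
        obtain ⟨s, hs, has⟩ := (hok ⟨a, hv⟩).2
        exact ⟨s, hS _ hs, has⟩
    · have h1 := card_union_le (S j) (F j)
      have h2 := hFc j
      have h3 := h.le j
      omega
    · rw [disjoint_union_left, disjoint_union_right, disjoint_union_right]
      exact ⟨⟨h.disj i j hij, hSF i j⟩, (hSF j i).symm, hFF i j hij⟩
  refine ⟨_, hT, fun j => ?_⟩
  have htot : ∑ j, (S j ∪ F j).card = ∑ j, ℓ j := by
    rw [← hT.card_biUnion, hn, ← card_univ]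
    congr 1
    rw [eq_univ_iff_forall]
    intro v
    by_cases hv : v ∈ univ.biUnion S
    · obtain ⟨j, hj, hv⟩ := mem_biUnion.1 hv
      exact mem_biUnion.2 ⟨j, hj, mem_union_left _ hv⟩
    · exact mem_biUnion.2 ⟨(f ⟨v, hv⟩).1, mem_univ _, mem_union_right _ (hFm.2 ⟨hv, rfl⟩)⟩
  exact (sum_eq_sum_iff_of_le fun j _ => hT.le j).1 htot j (mem_univ j)

/-- Completing small strong sets that are adjacent to most vertices into a partition of the
vertex set with the prescribed sizes. -/
theorem Valid.complete {S₀ : Fin t → Finset V} (h : Valid r ℓ x S₀)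
    (hn : ∑ j, ℓ j = Fintype.card V) (hn0 : 0 < ∑ j, ℓ j) (ht : 1000 * t ≤ ∑ j, ℓ j)
    {M EA EB : Finset V} {U : V → Finset V}
    (hsz : 4 * ((univ.biUnion S₀).card + 7 * M.card + 3 * EA.card + 3 * EB.card) ≤ ∑ j, ℓ j)
    (hUc : ∀ y ∈ M, (U y).card ≤ 6) (hUS : ∀ y ∈ M, Disjoint (U y) (univ.biUnion S₀))
    (hUM : ∀ y ∈ M, Disjoint (U y) M)
    (hUU : ∀ y ∈ M, ∀ z ∈ M, y ≠ z → Disjoint (U y) (U z))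
    (hU : ∀ y ∈ M, Abs r (U y) (Fit r ℓ S₀) (Fit (Function.swap r) ℓ S₀) ∧
      Abs r (insert y (U y)) (Fit r ℓ S₀) (Fit (Function.swap r) ℓ S₀))
    {D : Finset V} (hD : D = univ.biUnion S₀ ∪ (M ∪ M.biUnion U))
    (hA : ∀ v ∉ D, v ∉ EA → Fit r ℓ S₀ v)
    (hB : ∀ v ∉ D, v ∉ EB → Fit (Function.swap r) ℓ S₀ v)
    (hEA : ∀ v ∈ EA, v ∉ D → 6 * EA.card < ((outN r v \ D) \ EA).card)
    (hEB : ∀ v ∈ EB, v ∉ D → 6 * EB.card < ((outN (Function.swap r) v \ D) \ EB).card)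
    (hroot : ∀ j, (S₀ j).card < ℓ j →
      16 * (univ.filter fun v => v ∉ D ∧ ∀ s ∈ S₀ j, ¬ r v s).card ≤ ∑ j, ℓ j ∧
      16 * (univ.filter fun v => v ∉ D ∧ ∀ s ∈ S₀ j, ¬ r s v).card ≤ ∑ j, ℓ j) :
    ∃ T : Fin t → Finset V, Valid r ℓ x T ∧ ∀ j, (T j).card = ℓ j := by
  obtain ⟨S₁, h1, h1S, h1D⟩ := h.absorb_private hn0 ht (by omega) hUc hUS hUM hUU hU
  rw [← hD] at h1D
  have hDc : D.card ≤ (univ.biUnion S₀).card + 7 * M.card := by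
    rw [hD]
    have h1 := card_union_le (univ.biUnion S₀) (M ∪ M.biUnion U)
    have h2 := card_union_le M (M.biUnion U)
    have h3 : (M.biUnion U).card ≤ M.card * 6 := card_biUnion_le_card_mul _ _ _ hUc
    omega
  have hfin : ∀ S : Fin t → Finset V, Valid r ℓ x S → (∀ j, S₁ j ⊆ S j) →
      D ⊆ univ.biUnion S → EA ⊆ univ.biUnion S → EB ⊆ univ.biUnion S →
      (univ.biUnion S \ D).card ≤ 3 * EA.card + 3 * EB.card →
      ∃ T : Fin t → Finset V, Valid r ℓ x T ∧ ∀ j, (T j).card = ℓ j := by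
    intro S hS hSS hDS hES hES' hc
    have hc2 := card_sdiff_add_card_eq_card hDS
    refine hS.distribute (S₀ := S₀) (fun j => (h1S j).trans (hSS j)) hn (by omega) ?_ ?_
    · exact fun v hv => ⟨hA v (fun h => hv (hDS h)) fun h => hv (hES h),
        hB v (fun h => hv (hDS h)) fun h => hv (hES' h)⟩
    · intro j hj
      obtain ⟨g1, g2⟩ := hroot j
        ((card_le_card ((h1S j).trans (hSS j))).trans_lt hj)
      constructor
      · refine le_trans (Nat.mul_le_mul_left _ (card_le_card fun v hv => ?_)) g1
        have := (mem_filter.1 hv).2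
        exact mem_filter.2 ⟨mem_univ _, fun h => this.1 (hDS h), this.2⟩
      · refine le_trans (Nat.mul_le_mul_left _ (card_le_card fun v hv => ?_)) g2
        have := (mem_filter.1 hv).2
        exact mem_filter.2 ⟨mem_univ _, fun h => this.1 (hDS h), this.2⟩
  have step : ∀ S : Fin t → Finset V, Valid r ℓ x S → (∀ j, S₁ j ⊆ S j) →
      D ⊆ univ.biUnion S → ∀ Q : Finset V,
      (univ.biUnion S \ D).card + 3 * Q.card ≤ 3 * EA.card + 3 * EB.card →
      (∀ v ∈ Q, v ∉ univ.biUnion S → v ∈ EA →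
        (univ.biUnion S \ D).card + 3 * Q.card ≤ 6 * EA.card) →
      (∀ v ∈ Q, v ∉ univ.biUnion S → v ∈ EB →
        (univ.biUnion S \ D).card + 3 * Q.card ≤ 6 * EB.card) →
      ∃ S', Valid r ℓ x S' ∧ (∀ j, S₁ j ⊆ S' j) ∧ D ⊆ univ.biUnion S' ∧
        univ.biUnion S ⊆ univ.biUnion S' ∧ Q ⊆ univ.biUnion S' ∧
        (univ.biUnion S' \ D).card ≤ (univ.biUnion S \ D).card + 3 * Q.card := by
    intro S hS hSS hDS Q hQ hQA hQB
    have hc := card_sdiff_add_card_eq_card hDS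
    have hnb : ∀ (E N : Finset V), (univ.biUnion S \ D).card + 3 * Q.card ≤ 6 * E.card →
        6 * E.card < ((N \ D) \ E).card →
        3 * Q.card < (((N \ D) \ E) \ univ.biUnion S).card := by
      intro E N h1 h2
      have h3 := le_card_sdiff (univ.biUnion S \ D) ((N \ D) \ E)
      have h4 : ((N \ D) \ E) \ (univ.biUnion S \ D) = ((N \ D) \ E) \ univ.biUnion S := by
        ext a; simp only [mem_sdiff]; tauto
      rw [h4] at h3
      omega
    obtain ⟨S', g1, g2, g3, g4, g5⟩ := hS.absorb_neighbours (S₀ := S₀) (Q := Q) (EA := EA)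
      (EB := EB) (fun j => (h1S j).trans (hSS j)) hn0 ht (by omega)
      (fun v hv => hA v fun h => hv (hDS h)) (fun v hv => hB v fun h => hv (hDS h))
      (fun v hv hvS hvE => ⟨_, hnb EA _ (hQA v hv hvS hvE) (hEA v hvE fun h => hvS (hDS h)),
        fun u hu => by simp only [mem_sdiff, mem_outN] at hu; tauto⟩)
      (fun v hv hvS hvE => ⟨_, hnb EB _ (hQB v hv hvS hvE) (hEB v hvE fun h => hvS (hDS h)),
        fun u hu => by simp only [mem_sdiff, mem_outN, Function.swap] at hu; tauto⟩)
    refine ⟨S', g1, fun j => (hSS j).trans (g2 j), hDS.trans g3, g3, g4, ?_⟩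
    have : univ.biUnion S' \ D ⊆ (univ.biUnion S' \ univ.biUnion S) ∪ (univ.biUnion S \ D) := by
      intro a; simp only [mem_sdiff, mem_union]; tauto
    have := (card_le_card this).trans (card_union_le _ _)
    omega
  have h0 : (univ.biUnion S₁ \ D).card = 0 := by rw [h1D]; simp
  rcases le_total EA.card EB.card with hle | hle
  · obtain ⟨S₂, g1, g2, g3, g4, g5, g6⟩ := step S₁ h1 (fun j => subset_rfl) h1D.ge EA (by omega)
      (fun _ _ _ _ => by omega) (fun _ _ _ _ => by omega)
    obtain ⟨S₃, k1, k2, k3, k4, k5, k6⟩ := step S₂ g1 g2 g3 EB (by omega)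
      (fun v _ hv hv' => absurd (g5 hv') hv) (fun _ _ _ _ => by omega)
    exact hfin S₃ k1 k2 k3 (g5.trans k4) k5 (by omega)
  · obtain ⟨S₂, g1, g2, g3, g4, g5, g6⟩ := step S₁ h1 (fun j => subset_rfl) h1D.ge EB (by omega)
      (fun _ _ _ _ => by omega) (fun _ _ _ _ => by omega)
    obtain ⟨S₃, k1, k2, k3, k4, k5, k6⟩ := step S₂ g1 g2 g3 EA (by omega)
      (fun _ _ _ _ => by omega) (fun v _ hv hv' => absurd (g5 hv') hv)
    exact hfin S₃ k1 k2 k3 k5 (g5.trans k4) (by omega)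

end

noncomputable section

variable {V : Type} {r : V → V → Prop} {t N : ℕ}

/-- The indices of the sets `A k` to which `v` sends no edge. -/
def avoided (r : V → V → Prop) (A : Fin N → Finset V) (v : V) : Finset (Fin N) :=
  univ.filter fun k => ∀ a ∈ A k, ¬ r v a

theorem mem_avoided {A : Fin N → Finset V} {v : V} {k : Fin N} :
    k ∈ avoided r A v ↔ ∀ a ∈ A k, ¬ r v a := by
  simp [avoided]

/-- The number of sets `A k` to which `v` sends no edge. -/
def bad (r : V → V → Prop) (A : Fin N → Finset V) (v : V) : ℕ :=
  (avoided r A v).card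

/-- `v` lies outside `R` and sends edges to all but at most `t` of the sets `A k`. -/
def Good (t : ℕ) (r : V → V → Prop) (A : Fin N → Finset V) (R : Finset V) (v : V) : Prop :=
  v ∉ R ∧ bad r A v ≤ t

/-- Indices of the vertices `x j` and of the two kinds of pieces. -/
abbrev Idx (t N : ℕ) : Type := Fin t ⊕ Fin N ⊕ Fin N

/-- The vertex sets corresponding to the indices. -/
def base (x : Fin t → V) (A B : Fin N → Finset V) : Idx t N → Finset V
  | .inl j => {x j}
  | .inr (.inl k) => A k
  | .inr (.inr k) => B k

variable [Fintype V]

/-- All but few vertices send edges to each `A k`. -/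
def Dominated (r : V → V → Prop) (A : Fin N → Finset V) (R : Finset V) : Prop :=
  ∀ k, ∀ v ∉ R, 2 ^ 40 * (univ.filter fun w => w ∉ R ∧ ∀ a ∈ A k, ¬ r w a).card ≤ (outN r v).card

theorem Dominated.card_bad_le {A : Fin N → Finset V} {R : Finset V} (h : Dominated r A R) {v : V}
    (hv : v ∉ R) (θ : ℕ) :
    2 ^ 40 * (θ * (univ.filter fun w => w ∉ R ∧ θ ≤ bad r A w).card) ≤ N * (outN r v).card := by
  have h1 : (univ.filter fun w => w ∉ R ∧ θ ≤ bad r A w).card • θ ≤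
      ∑ w ∈ univ.filter fun w => w ∉ R ∧ θ ≤ bad r A w, bad r A w :=
    card_nsmul_le_sum _ _ _ fun w hw => (mem_filter.1 hw).2.2
  have h2 : ∑ w ∈ univ.filter fun w => w ∉ R ∧ θ ≤ bad r A w, bad r A w ≤
      ∑ w ∈ univ.filter fun w => w ∉ R, bad r A w :=
    sum_le_sum_of_subset fun w hw => by
      rw [mem_filter] at hw ⊢; exact ⟨hw.1, hw.2.1⟩
  have h3 : ∑ w ∈ univ.filter fun w => w ∉ R, bad r A w =
      ∑ k, (univ.filter fun w => w ∉ R ∧ ∀ a ∈ A k, ¬ r w a).card := by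
    have := sum_card_bipartiteAbove_eq_sum_card_bipartiteBelow
      (s := univ.filter fun w => w ∉ R) (t := (univ : Finset (Fin N)))
      (fun w k => ∀ a ∈ A k, ¬ r w a)
    simp only [bipartiteAbove, bipartiteBelow, filter_filter] at this
    convert this using 3
    rw [bad]
    congr 1
    ext k
    simp [mem_avoided]
  calc _ ≤ 2 ^ 40 * ∑ k, (univ.filter fun w => w ∉ R ∧ ∀ a ∈ A k, ¬ r w a).card := by
        refine Nat.mul_le_mul_left _ ?_
        rw [← h3, mul_comm]
        exact h1.trans h2
    _ = ∑ k, 2 ^ 40 * (univ.filter fun w => w ∉ R ∧ ∀ a ∈ A k, ¬ r w a).card := mul_sum _ _ _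
    _ ≤ ∑ _k : Fin N, (outN r v).card := sum_le_sum fun k _ => h k v hv
    _ = _ := by simp

theorem Dominated.exists_good {A : Fin N → Finset V} {R F : Finset V} (h : Dominated r A R)
    (hN : N = 10 ^ 7 * t) (hRF : R ⊆ F) {u : V} (hu : u ∉ F)
    (hF : 2 * F.card < (outN r u).card) : ∃ a ∉ F, r u a ∧ Good t r A R a := by
  by_contra! hcon
  have h1 := h.card_bad_le (fun hh => hu (hRF hh)) (t + 1)
  have hsub : outN r u ⊆ F ∪ univ.filter fun w => w ∉ R ∧ t + 1 ≤ bad r A w := by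
    intro a ha
    by_cases haF : a ∈ F
    · exact mem_union_left _ haF
    refine mem_union_right _ (mem_filter.2 ⟨mem_univ _, fun hh => haF (hRF hh), ?_⟩)
    by_contra hlt
    exact hcon a haF (mem_outN.1 ha) ⟨fun hh => haF (hRF hh), by omega⟩
  have h2 := (card_le_card hsub).trans (card_union_le _ _)
  have h3 : 2 ^ 40 * ((univ.filter fun w => w ∉ R ∧ t + 1 ≤ bad r A w).card) * (t + 1) ≤
      10 ^ 7 * (outN r u).card * (t + 1) := by
    calc _ ≤ N * (outN r u).card := by rw [mul_assoc, mul_comm _ (t + 1)]; exact h1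
      _ = 10 ^ 7 * (outN r u).card * t := by rw [hN]; ring
      _ ≤ _ := Nat.mul_le_mul_left _ (by omega)
  have h4 := Nat.le_of_mul_le_mul_right h3 (by omega)
  omega

/-- The reserved structures of the digraph. -/
structure Config (r : V → V → Prop) (t N : ℕ) (x : Fin t → V) where
  A : Fin N → Finset V
  B : Fin N → Finset V
  U : Idx t N → Finset V
  Pv : V → Finset V
  R₀ : Finset V
  M : Finset V
  R : Finset V
  R₀_eq : R₀ = univ.biUnion (base x A B)
  M_eq : M = R₀ ∪ univ.biUnion U
  R_eq : R = M ∪ M.biUnion Pv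
  base_ne : ∀ i, (base x A B i).Nonempty
  base_strong : ∀ i, StrongOn r (base x A B i)
  base_card : ∀ i, (base x A B i).card ≤ 43
  base_disj : ∀ i i', i ≠ i' → Disjoint (base x A B i) (base x A B i')
  domA : Dominated r A R₀
  domB : Dominated (Function.swap r) B R₀
  U_ne : ∀ i, (U i).Nonempty
  U_card : ∀ i, (U i).card ≤ 6
  U_R₀ : ∀ i, Disjoint (U i) R₀
  U_disj : ∀ i i', i ≠ i' → Disjoint (U i) (U i')
  abs : ∀ i, Abs r (base x A B i ∪ U i) (Good t r A R₀) (Good t (Function.swap r) B R₀)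
  Pv_card : ∀ y ∈ M, (Pv y).card ≤ 6
  Pv_M : ∀ y ∈ M, Disjoint (Pv y) M
  Pv_disj : ∀ y ∈ M, ∀ z ∈ M, y ≠ z → Disjoint (Pv y) (Pv z)
  Pv_abs : ∀ y ∈ M, Abs r (Pv y) (Good t r A R₀) (Good t (Function.swap r) B R₀) ∧
    Abs r (insert y (Pv y)) (Good t r A R₀) (Good t (Function.swap r) B R₀)
  M_card : M.card ≤ 10 ^ 10 * t
  R_card : R.card ≤ 10 ^ 11 * t

theorem exists_config (hs : Semi r) (ht : 0 < t) (hN : N = 10 ^ 7 * t) {x : Fin t → V}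
    (hx : Function.Injective x) (hout : ∀ v, 10 ^ 13 * t < (outN r v).card)
    (hin : ∀ v, 10 ^ 13 * t < (outN (Function.swap r) v).card) : Nonempty (Config r t N x) := by
  have hne : Nonempty V := ⟨x ⟨0, ht⟩⟩
  obtain ⟨Y, hY, hYd⟩ := exists_greedy (ι := Fin N ⊕ Fin N) (α := V)
    (fun i Y F => Y.Nonempty ∧ StrongOn r Y ∧ match i with
      | .inl _ => ∀ v ∉ F, 2 ^ 40 *
          ((univ.filter fun w => w ∉ F ∧ w ∉ Y ∧ ∀ a ∈ Y, ¬ r w a).card) ≤ (outN r v).card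
      | .inr _ => ∀ v ∉ F, 2 ^ 40 *
          ((univ.filter fun w => w ∉ F ∧ w ∉ Y ∧ ∀ a ∈ Y, ¬ Function.swap r w a).card) ≤
            (outN (Function.swap r) v).card)
    (by
      rintro (i | i) Y F F' hFF ⟨h1, h2, h3⟩
      · refine ⟨h1, h2, fun v hv => le_trans (Nat.mul_le_mul_left _ (card_le_card fun w hw => ?_))
          (h3 v fun h => hv (hFF h))⟩
        rw [mem_filter] at hw ⊢
        exact ⟨hw.1, fun h => hw.2.1 (hFF h), hw.2.2⟩
      · refine ⟨h1, h2, fun v hv => le_trans (Nat.mul_le_mul_left _ (card_le_card fun w hw => ?_))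
          (h3 v fun h => hv (hFF h))⟩
        rw [mem_filter] at hw ⊢
        exact ⟨hw.1, fun h => hw.2.1 (hFF h), hw.2.2⟩)
    (fun _ => 43) (univ.image x) univ
    (by
      intro i _ F _ hF
      have h1 : (univ.image x).card ≤ t := card_image_le.trans (by simp)
      have h2 : F.card ≤ 10 ^ 13 * t := by
        simp only [sum_const, card_univ, Fintype.card_sum, Fintype.card_fin, smul_eq_mul] at hF
        omega
      rcases i with i | i
      · obtain ⟨Y, g1, g2, g3, g4, g5⟩ := exists_piece hs (F := F)
          (fun v => h2.trans_lt (hout v)) 40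
        exact ⟨Y, g2, g4, g1, g3, g5⟩
      · obtain ⟨Y, g1, g2, g3, g4, g5⟩ := exists_piece hs.swap (F := F)
          (fun v => h2.trans_lt (hin v)) 40
        exact ⟨Y, g2, g4, g1, strongOn_swap.1 g3, g5⟩)
  set A : Fin N → Finset V := fun k => Y (.inl k) with hA
  set B : Fin N → Finset V := fun k => Y (.inr k) with hB
  set R₀ : Finset V := univ.biUnion (base x A B) with hR₀
  have hR₀sub : ∀ i, base x A B i ⊆ R₀ := fun i => subset_biUnion_of_mem _ (mem_univ i)
  have hR₀eq : univ.image x ∪ univ.biUnion Y = R₀ := by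
    ext v
    simp only [mem_union, mem_image, mem_univ, true_and, mem_biUnion, hR₀, Sum.exists, base,
      mem_singleton, hA, hB, eq_comm]
  have hYm : ∀ i w, w ∈ Y i → w ∈ R₀ := fun i w hw => by
    rw [← hR₀eq]; exact mem_union_right _ (mem_biUnion.2 ⟨i, mem_univ _, hw⟩)
  have hdomA : Dominated r A R₀ := by
    intro k v hv
    have := (hY (.inl k) (mem_univ _)).2.2.2.2
    simp only [hR₀eq] at this
    refine le_trans (Nat.mul_le_mul_left _ (card_le_card fun w hw => ?_)) (this v hv)
    rw [mem_filter] at hw ⊢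
    exact ⟨hw.1, hw.2.1, fun h => hw.2.1 (hYm _ _ h), hw.2.2⟩
  have hdomB : Dominated (Function.swap r) B R₀ := by
    intro k v hv
    have := (hY (.inr k) (mem_univ _)).2.2.2.2
    simp only [hR₀eq] at this
    refine le_trans (Nat.mul_le_mul_left _ (card_le_card fun w hw => ?_)) (this v hv)
    rw [mem_filter] at hw ⊢
    exact ⟨hw.1, hw.2.1, fun h => hw.2.1 (hYm _ _ h), hw.2.2⟩
  have hbne : ∀ i, (base x A B i).Nonempty := by
    rintro (j | k | k)
    · exact ⟨x j, by simp [base]⟩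
    · exact (hY (.inl k) (mem_univ _)).2.2.1
    · exact (hY (.inr k) (mem_univ _)).2.2.1
  have hbst : ∀ i, StrongOn r (base x A B i) := by
    rintro (j | k | k)
    · intro u hu v hv
      rw [base, mem_singleton] at hu hv
      subst hu; subst hv; exact ReflTransGen.refl
    · exact (hY (.inl k) (mem_univ _)).2.2.2.1
    · exact (hY (.inr k) (mem_univ _)).2.2.2.1
  have hbc : ∀ i, (base x A B i).card ≤ 43 := by
    rintro (j | k | k)
    · simp [base]
    · exact (hY (.inl k) (mem_univ _)).2.1
    · exact (hY (.inr k) (mem_univ _)).2.1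
  have hxY : ∀ j i, Disjoint {x j} (Y i) := fun j i =>
    ((hY i (mem_univ _)).1.mono_right (by simp)).symm
  have hYd' : ∀ i i', i ≠ i' → Disjoint (Y i) (Y i') := fun i i' h =>
    hYd i (mem_univ _) i' (mem_univ _) h
  have hbd : ∀ i i', i ≠ i' → Disjoint (base x A B i) (base x A B i') := by
    rintro (j | k | k) (j' | k' | k') h
    · simp only [base, disjoint_singleton]
      exact fun hh => h (congrArg _ (hx hh))
    · exact hxY _ _
    · exact hxY _ _
    · exact (hxY _ _).symm
    · exact hYd' _ _ fun hh => h (by cases hh; rfl)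
    · exact hYd' _ _ (by simp)
    · exact (hxY _ _).symm
    · exact hYd' _ _ (by simp)
    · exact hYd' _ _ fun hh => h (by cases hh; rfl)
  have hIdx : Fintype.card (Idx t N) = t + 2 * N := by
    simp [Idx]; omega
  have hR₀c : R₀.card ≤ 10 ^ 9 * t := by
    have : R₀.card ≤ Fintype.card (Idx t N) * 43 :=
      card_biUnion_le_card_mul _ _ _ fun i _ => hbc i
    omega
  have hunit : ∀ F : Finset V, R₀ ⊆ F → F.card ≤ 10 ^ 11 * t → ∀ y, ∃ Y : Finset V,
      Y.Nonempty ∧ Y.card ≤ 6 ∧ Disjoint Y F ∧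
      Abs r Y (Good t r A R₀) (Good t (Function.swap r) B R₀) ∧
      Abs r (insert y Y) (Good t r A R₀) (Good t (Function.swap r) B R₀) := by
    intro F hRF hF y
    have hnb : ∀ q : V → V → Prop, (∀ v, 10 ^ 13 * t < (outN q v).card) → ∃ u ∉ F, q y u := by
      intro q hq
      by_contra! hcon
      have h1 : outN q y ⊆ F := fun u hu => by
        by_contra h; exact hcon u h (mem_outN.1 hu)
      have := card_le_card h1
      have := hq y
      omega
    refine exists_unit (fun u hu => ?_) (fun u hu => ?_) (hnb r hout) (hnb _ hin)
    · exact hdomA.exists_good hN hRF hu (by have := hout u; omega)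
    · exact hdomB.exists_good hN hRF hu (by have := hin u; omega)
  obtain ⟨U, hU, hUd⟩ := exists_greedy (ι := Idx t N) (α := V)
    (fun i Y _ => Y.Nonempty ∧
      Abs r (base x A B i ∪ Y) (Good t r A R₀) (Good t (Function.swap r) B R₀))
    (fun _ _ _ _ _ h => h) (fun _ => 6) R₀ univ
    (by
      intro i _ F hRF hF
      obtain ⟨y, hy⟩ := hbne i
      simp only [sum_const, card_univ, hIdx, smul_eq_mul] at hF
      obtain ⟨Y, g1, g2, g3, g4, g5⟩ := hunit F hRF (by omega) y
      exact ⟨Y, g3, g2, g1, Abs.union_strong (hbst i) hy g5⟩)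
  set M := R₀ ∪ univ.biUnion U with hM
  have hMc : M.card ≤ 10 ^ 10 * t := by
    have h1 : M.card ≤ R₀.card + (univ.biUnion U).card := card_union_le _ _
    have h2 : (univ.biUnion U).card ≤ Fintype.card (Idx t N) * 6 :=
      card_biUnion_le_card_mul _ _ _ fun i hi => (hU i hi).2.1
    omega
  obtain ⟨Pv, hPv, hPvd⟩ := exists_greedy (ι := V) (α := V)
    (fun y Y _ => Abs r Y (Good t r A R₀) (Good t (Function.swap r) B R₀) ∧
      Abs r (insert y Y) (Good t r A R₀) (Good t (Function.swap r) B R₀))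
    (fun _ _ _ _ _ h => h) (fun _ => 6) M M
    (by
      intro y _ F hMF hF
      simp only [sum_const, smul_eq_mul] at hF
      obtain ⟨Y, g1, g2, g3, g4, g5⟩ := hunit F (subset_union_left.trans hMF) (by omega) y
      exact ⟨Y, g3, g2, g4, g5⟩)
  have hRc : (M ∪ M.biUnion Pv).card ≤ 10 ^ 11 * t := by
    have h1 := card_union_le M (M.biUnion Pv)
    have h2 : (M.biUnion Pv).card ≤ M.card * 6 :=
      card_biUnion_le_card_mul _ _ _ fun i hi => (hPv i hi).2.1
    omega
  exact ⟨⟨A, B, U, Pv, R₀, M, M ∪ M.biUnion Pv, rfl, rfl, rfl, hbne, hbst, hbc, hbd, hdomA, hdomB,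
    fun i => (hU i (mem_univ _)).2.2.1, fun i => (hU i (mem_univ _)).2.1,
    fun i => (hU i (mem_univ _)).1, fun i i' h => hUd i (mem_univ _) i' (mem_univ _) h,
    fun i => (hU i (mem_univ _)).2.2.2, fun y hy => (hPv y hy).2.1, fun y hy => (hPv y hy).1,
    hPvd, fun y hy => (hPv y hy).2.2, hMc, hRc⟩⟩

end

noncomputable section

variable {V : Type} [Fintype V] {r : V → V → Prop} {t N : ℕ}

section Side

variable {A : Fin N → Finset V} {R₀ : Finset V} {U : Idx t N → Finset V}

/-- The indices `i` for which some good vertex of `U i` sends no edge to `A k`. -/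
def conf (r : V → V → Prop) (A : Fin N → Finset V) (R₀ : Finset V) (U : Idx t N → Finset V)
    (k : Fin N) : Finset (Idx t N) :=
  univ.filter fun i => ∃ a ∈ U i, Good t r A R₀ a ∧ ∀ b ∈ A k, ¬ r a b

/-- `A k` is popular: it is avoided by the good vertices of few of the sets `U i`. -/
def Pop (r : V → V → Prop) (A : Fin N → Finset V) (R₀ : Finset V) (U : Idx t N → Finset V)
    (k : Fin N) : Prop :=
  10 * (conf r A R₀ U k).card ≤ N

theorem exists_edge_of_not_mem_conf {k : Fin N} {i : Idx t N} (h : i ∉ conf r A R₀ U k) {a : V}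
    (ha : a ∈ U i) (hg : Good t r A R₀ a) : ∃ b ∈ A k, r a b := by
  by_contra! hcon
  exact h (mem_filter.2 ⟨mem_univ _, a, ha, hg, hcon⟩)

theorem card_mem_conf_le (hU : ∀ i, (U i).card ≤ 6) (i : Idx t N) :
    (univ.filter fun k => i ∈ conf r A R₀ U k).card ≤ 6 * t := by
  have hsub : (univ.filter fun k => i ∈ conf r A R₀ U k) ⊆
      ((U i).filter (Good t r A R₀)).biUnion (avoided r A) := by
    intro k hk
    obtain ⟨a, ha, hg, hb⟩ := (mem_filter.1 (mem_filter.1 hk).2).2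
    exact mem_biUnion.2 ⟨a, mem_filter.2 ⟨ha, hg⟩, mem_avoided.2 hb⟩
  refine (card_le_card hsub).trans ((card_biUnion_le_card_mul _ _ t ?_).trans
    (Nat.mul_le_mul_right _ ((card_filter_le _ _).trans (hU i))))
  intro a ha
  exact (mem_filter.1 ha).2.2

theorem card_not_pop_le (hU : ∀ i, (U i).card ≤ 6) (ht : 0 < t) (hN : N = 10 ^ 7 * t) :
    (univ.filter fun k => ¬ Pop r A R₀ U k).card ≤ 130 * t := by
  have h1 : ∑ k, (conf r A R₀ U k).card ≤ (2 * N + t) * (6 * t) := by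
    have h := sum_card_bipartiteAbove_eq_sum_card_bipartiteBelow
      (s := (univ : Finset (Idx t N))) (t := (univ : Finset (Fin N)))
      (fun i k => i ∈ conf r A R₀ U k)
    have h2 : ∀ k, bipartiteBelow (fun i k => i ∈ conf r A R₀ U k) univ k = conf r A R₀ U k := by
      intro k; ext i; simp [bipartiteBelow]
    simp only [h2] at h
    rw [← h]
    refine (sum_le_card_nsmul _ _ (6 * t) fun i _ => ?_).trans ?_
    · exact card_mem_conf_le hU i
    · simp only [card_univ, Idx, Fintype.card_sum, Fintype.card_fin, smul_eq_mul]
      exact Nat.mul_le_mul_right _ (by omega)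
  have h2 : (univ.filter fun k => ¬ Pop r A R₀ U k).card * N ≤
      ∑ k ∈ univ.filter fun k => ¬ Pop r A R₀ U k, 10 * (conf r A R₀ U k).card := by
    refine (smul_eq_mul (α := ℕ) _ _).symm.le.trans (card_nsmul_le_sum _ _ _ fun k hk => ?_)
    have := (mem_filter.1 hk).2
    rw [Pop] at this
    omega
  have h4 : (univ.filter fun k => ¬ Pop r A R₀ U k).card * N ≤ 130 * t * N := by
    refine h2.trans ((sum_le_sum_of_subset (filter_subset _ _)).trans ?_)
    rw [← mul_sum]
    refine (Nat.mul_le_mul_left _ h1).trans ?_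
    rw [hN]
    nlinarith
  exact Nat.le_of_mul_le_mul_right h4 (by omega)

theorem exists_link (hU : ∀ i, (U i).card ≤ 6) {emb : Fin N → Idx t N}
    (hemb : Function.Injective emb) {X : Finset (Idx t N)} (i : Idx t N)
    (hX : X.card + 6 * t < N) : ∃ k, emb k ∉ X ∧ i ∉ conf r A R₀ U k := by
  by_contra! hcon
  have hsub : (univ : Finset (Fin N)) ⊆ (univ.filter fun k => emb k ∈ X) ∪
      univ.filter fun k => i ∈ conf r A R₀ U k := by
    intro k _
    by_cases hk : emb k ∈ X
    · exact mem_union_left _ (by simpa using hk)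
    · exact mem_union_right _ (by simpa using hcon k hk)
  have h1 := (card_le_card hsub).trans (card_union_le _ _)
  have h2 := card_mem_conf_le (r := r) (A := A) (R₀ := R₀) hU i
  have h3 : (univ.filter fun k => emb k ∈ X).card ≤ X.card :=
    card_le_card_of_injOn emb (fun k hk => (mem_filter.1 hk).2) hemb.injOn
  rw [card_univ, Fintype.card_fin] at h1
  omega

/-- The popular indices that are not used. -/
def free (r : V → V → Prop) (A : Fin N → Finset V) (R₀ : Finset V) (U : Idx t N → Finset V)
    (emb : Fin N → Idx t N) (used : Finset (Idx t N)) : Finset (Fin N) :=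
  univ.filter fun k => Pop r A R₀ U k ∧ emb k ∉ used

theorem card_not_free_le (hU : ∀ i, (U i).card ≤ 6) (ht : 0 < t) (hN : N = 10 ^ 7 * t)
    {emb : Fin N → Idx t N} (hemb : Function.Injective emb) {used : Finset (Idx t N)}
    (hc : used.card ≤ 5 * t) (F : Finset (Fin N)) (hF : Disjoint F (free r A R₀ U emb used)) :
    F.card ≤ 135 * t := by
  have hsub : F ⊆ (univ.filter fun k => emb k ∈ used) ∪ univ.filter fun k => ¬ Pop r A R₀ U k := by
    intro k hk
    have := disjoint_left.1 hF hk
    simp only [free, mem_filter, mem_univ, true_and, mem_union] at this ⊢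
    tauto
  have h1 := (card_le_card hsub).trans (card_union_le _ _)
  have h2 := card_not_pop_le (r := r) (A := A) (R₀ := R₀) hU ht hN
  have h3 : (univ.filter fun k => emb k ∈ used).card ≤ used.card :=
    card_le_card_of_injOn emb (fun k hk => (mem_filter.1 hk).2) hemb.injOn
  omega

/-- The used part `X` of `core` contains few out-neighbours of the unused popular sets and of the
vertices sending no edges to many of the sets `A k`. -/
structure Side (r : V → V → Prop) (A : Fin N → Finset V) (R₀ : Finset V) (U : Idx t N → Finset V)
    (emb : Fin N → Idx t N) (core X : Finset V) (used : Finset (Idx t N)) (m : ℕ) : Prop where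
  far : ∀ v ∈ core, v ∉ X → 200 * t ≤ bad r A v → (X.filter (r v)).card ≤ 2 * m
  near : ∀ k ∈ free r A R₀ U emb used, ∀ a ∈ A k, (X.filter (r a)).card ≤ m

theorem Side.step (hs : Semi r) (hU : ∀ i, (U i).card ≤ 6) (ht : 0 < t) (hN : N = 10 ^ 7 * t)
    {emb : Fin N → Idx t N} (hemb : Function.Injective emb) {core X P P' : Finset V}
    {used used' : Finset (Idx t N)} {m : ℕ} (h : Side r A R₀ U emb core X used m)
    (hc : used.card ≤ 5 * t) (hne : ∀ k, (A k).Nonempty) (hA : ∀ k, Disjoint (A k) core)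
    (hu : used ⊆ used') (hP : P' ⊆ P)
    (h1 : ∀ v ∈ core \ X, (∃ s ∈ (free r A R₀ U emb used).biUnion A, r s v) →
      (P.filter (r v)).card ≤ 2)
    (h2 : ∀ v ∈ (free r A R₀ U emb used).biUnion A, (P.filter (r v)).card ≤ 1) :
    Side r A R₀ U emb core (X ∪ P') used' (m + 1) := by
  have hP' : ∀ v, (P'.filter (r v)).card ≤ (P.filter (r v)).card := fun v =>
    card_le_card (filter_subset_filter _ hP)
  have hun : ∀ v, ((X ∪ P').filter (r v)).card ≤ (X.filter (r v)).card + (P.filter (r v)).card :=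
    fun v => by
      rw [filter_union]
      exact (card_union_le _ _).trans (Nat.add_le_add_left (hP' v) _)
  refine ⟨fun v hv hvX hb => ?_, fun k hk a ha => ?_⟩
  · have hvX' : v ∉ X := fun hh => hvX (mem_union_left _ hh)
    have h3 := h.far v hv hvX' hb
    have h4 := h1 v (mem_sdiff.2 ⟨hv, hvX'⟩) (by
      have hnd : ¬ Disjoint (avoided r A v) (free r A R₀ U emb used) := by
        intro hd
        have := card_not_free_le hU ht hN hemb hc _ hd
        rw [bad] at hb
        omega
      obtain ⟨k, hk, hk'⟩ := not_disjoint_iff.1 hnd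
      obtain ⟨a, ha⟩ := hne k
      refine ⟨a, mem_biUnion.2 ⟨k, hk', ha⟩, hs.of_not ?_ (mem_avoided.1 hk a ha)⟩
      rintro rfl
      exact disjoint_left.1 (hA k) ha hv)
    have := hun v
    omega
  · have hk' : k ∈ free r A R₀ U emb used := by
      simp only [free, mem_filter, mem_univ, true_and] at hk ⊢
      exact ⟨hk.1, fun hh => hk.2 (hu hh)⟩
    have h3 := h.near k hk' a ha
    have h4 := h2 a (mem_biUnion.2 ⟨k, hk', ha⟩)
    have := hun a
    omega

theorem Side.exists_edge {emb : Fin N → Idx t N} {core X R : Finset V} {used : Finset (Idx t N)}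
    {m : ℕ} (h : Side r A R₀ U emb core X used m) (hcore : core = univ \ R) {s : V}
    (hs : s ∈ (free r A R₀ U emb used).biUnion A) (hd : R.card + m < (outN r s).card) :
    ∃ w ∈ core \ X, r s w := by
  by_contra! hcon
  obtain ⟨k, hk, hsk⟩ := mem_biUnion.1 hs
  have hsub : outN r s ⊆ R ∪ X.filter (r s) := by
    intro w hw
    rw [mem_outN] at hw
    by_contra hw'
    simp only [mem_union, mem_filter, not_or, not_and] at hw'
    exact hcon w (mem_sdiff.2 ⟨by rw [hcore]; simp [hw'.1], fun hX => hw'.2 hX hw⟩) hw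
  have h1 := (card_le_card hsub).trans (card_union_le _ _)
  have h2 := h.near k hk s hsk
  omega

end Side

end

noncomputable section

variable {V : Type} [Fintype V] {r : V → V → Prop} {t N : ℕ} {x : Fin t → V}

namespace Config

variable (c : Config r t N x)

/-- A vertex set of the configuration together with its absorber. -/
def block (i : Idx t N) : Finset V := base x c.A c.B i ∪ c.U i

/-- The vertices outside the configuration. -/
def core : Finset V := univ \ c.R

theorem base_subset (i : Idx t N) : base x c.A c.B i ⊆ c.R₀ := by
  rw [c.R₀_eq]
  exact subset_biUnion_of_mem _ (mem_univ i)

theorem M_subset_R : c.M ⊆ c.R := by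
  rw [c.R_eq]
  exact subset_union_left

theorem block_subset (i : Idx t N) : c.block i ⊆ c.M := by
  rw [c.M_eq]
  exact union_subset_union (c.base_subset i) (subset_biUnion_of_mem _ (mem_univ i))

theorem disjoint_core (i : Idx t N) : Disjoint (c.block i) c.core :=
  disjoint_sdiff.mono_left ((c.block_subset i).trans c.M_subset_R)

theorem block_card (i : Idx t N) : (c.block i).card ≤ 49 :=
  (card_union_le _ _).trans (Nat.add_le_add (c.base_card i) (c.U_card i))

theorem block_disj {i i' : Idx t N} (h : i ≠ i') : Disjoint (c.block i) (c.block i') := by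
  refine disjoint_union_left.2 ⟨disjoint_union_right.2 ⟨c.base_disj i i' h, ?_⟩,
    disjoint_union_right.2 ⟨?_, c.U_disj i i' h⟩⟩
  · exact (c.U_R₀ i').symm.mono_left (c.base_subset i)
  · exact (c.U_R₀ i).mono_right (c.base_subset i')

theorem mem_U {i : Idx t N} {v : V} (hv : v ∈ c.block i) (hR : v ∉ c.R₀) : v ∈ c.U i :=
  (mem_union.1 hv).resolve_left fun hh => hR (c.base_subset i hh)

theorem edgeA {i : Idx t N} {k : Fin N} (h : i ∉ conf r c.A c.R₀ c.U k) {v : V}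
    (hv : v ∈ c.block i) (hg : Good t r c.A c.R₀ v) : ∃ s ∈ c.A k, r v s :=
  exists_edge_of_not_mem_conf h (c.mem_U hv hg.1) hg

theorem edgeB {i : Idx t N} {k : Fin N} (h : i ∉ conf (Function.swap r) c.B c.R₀ c.U k) {v : V}
    (hv : v ∈ c.block i) (hg : Good t (Function.swap r) c.B c.R₀ v) : ∃ s ∈ c.B k, r s v :=
  exists_edge_of_not_mem_conf h (c.mem_U hv hg.1) hg

end Config

/-- The index of `A k`. -/
def emA (k : Fin N) : Idx t N := .inr (.inl k)

/-- The index of `B k`. -/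
def emB (k : Fin N) : Idx t N := .inr (.inr k)

theorem emA_injective : Function.Injective (emA : Fin N → Idx t N) :=
  Sum.inr_injective.comp Sum.inl_injective

theorem emB_injective : Function.Injective (emB : Fin N → Idx t N) :=
  Sum.inr_injective.comp Sum.inr_injective

/-- A vertex set, the indices of the blocks it uses, and the indices of the sets by which other
vertices are attached to it. -/
structure Bit (V : Type) (t N : ℕ) where
  S : Finset V
  own : Finset (Idx t N)
  ra : Fin N
  rb : Fin N

/-- `q` is an initial segment of the `j`-th cycle. -/
structure Piece (c : Config r t N x) (ℓ : Fin t → ℕ) (K : ℕ) (j : Fin t) (q : Bit V t N) :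
    Prop where
  mem : x j ∈ q.S
  strong : StrongOn r q.S
  le : q.S.card ≤ ℓ j
  own_card : q.own.card ≤ 5
  own_inl : ∀ i, Sum.inl i ∈ q.own → i = j
  sub : q.S ⊆ c.core ∪ q.own.biUnion c.block
  root : q.S.card < ℓ j → c.A q.ra ⊆ q.S ∧ c.B q.rb ⊆ q.S ∧ Pop r c.A c.R₀ c.U q.ra ∧
    Pop (Function.swap r) c.B c.R₀ c.U q.rb
  card : q.S.card * K ≤ Fintype.card V + 400 * K

theorem exists_piece_in (hs : Semi r) (c : Config r t N x) (ht : 0 < t) (hN : N = 10 ^ 7 * t)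
    {ℓ : Fin t → ℕ} {j : Fin t} (hj : 3 ≤ ℓ j) {W : Finset V} (hWc : W ⊆ c.core) {K k : ℕ}
    (hKk : K ≤ k) (hW : Kc r W (k + 4)) {used : Finset (Idx t N)} (hu : used.card ≤ 5 * t)
    (hju : Sum.inl j ∉ used)
    (hSo : ∀ s ∈ (free r c.A c.R₀ c.U emA used).biUnion c.A, ∃ w ∈ W, r s w)
    (hEi : ∀ e ∈ (free (Function.swap r) c.B c.R₀ c.U emB used).biUnion c.B, ∃ w ∈ W, r w e) :
    ∃ (q : Bit V t N) (P : Finset V), Piece c ℓ K j q ∧ Disjoint q.own used ∧ P ⊆ W ∧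
      q.S ∩ c.core ⊆ P ∧ Kc r (W \ (q.S ∩ c.core)) k ∧
      (∀ v ∈ W, (∃ s ∈ (free r c.A c.R₀ c.U emA used).biUnion c.A, r s v) →
        (P.filter (r v)).card ≤ 2) ∧
      (∀ v ∈ (free r c.A c.R₀ c.U emA used).biUnion c.A, (P.filter (r v)).card ≤ 1) ∧
      (∀ v ∈ W, (∃ e ∈ (free (Function.swap r) c.B c.R₀ c.U emB used).biUnion c.B, r v e) →
        (P.filter (Function.swap r v)).card ≤ 2) ∧
      ∀ v ∈ (free (Function.swap r) c.B c.R₀ c.U emB used).biUnion c.B,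
        (P.filter (Function.swap r v)).card ≤ 1 := by
  have hne : ∀ (r' : V → V → Prop) (A : Fin N → Finset V) (emb : Fin N → Idx t N),
      Function.Injective emb → (∀ k, (A k).Nonempty) →
      ((free r' A c.R₀ c.U emb used).biUnion A).Nonempty := by
    intro r' A emb hemb hA
    obtain ⟨k, hk⟩ : (free r' A c.R₀ c.U emb used).Nonempty := by
      by_contra hcon
      have := card_not_free_le (r := r') (A := A) (R₀ := c.R₀) c.U_card ht hN hemb hu univ
        (by rw [not_nonempty_iff_eq_empty.1 hcon]; exact disjoint_empty_right _)
      rw [card_univ, Fintype.card_fin] at this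
      omega
    obtain ⟨a, ha⟩ := hA k
    exact ⟨a, mem_biUnion.2 ⟨k, hk, ha⟩⟩
  obtain ⟨P, a, b, ha, hb, hPW, hPc, hab, hPk, e1, e2, e3, e4⟩ := exists_short_path hs hW
    (hne r c.A emA emA_injective fun k => c.base_ne (emA k))
    (hne (Function.swap r) c.B emB emB_injective fun k => c.base_ne (emB k))
    ((disjoint_biUnion_left _ _ _).2 fun k _ => (disjoint_biUnion_right _ _ _).2 fun k' _ =>
      c.base_disj (emA k) (emB k') (by simp [emA, emB])) hSo hEi
  obtain ⟨ka, hka, haA⟩ := mem_biUnion.1 ha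
  obtain ⟨kb, hkb, hbB⟩ := mem_biUnion.1 hb
  obtain ⟨hpa, hua⟩ := (mem_filter.1 hka).2
  obtain ⟨hpb, hub⟩ := (mem_filter.1 hkb).2
  set X := used ∪ (conf r c.A c.R₀ c.U ka ∪ conf (Function.swap r) c.B c.R₀ c.U kb) with hX
  have hXc : X.card + 6 * t < N := by
    have h1 : X.card ≤ used.card + _ := card_union_le _ _
    have h2 := card_union_le (conf r c.A c.R₀ c.U ka) (conf (Function.swap r) c.B c.R₀ c.U kb)
    rw [Pop] at hpa hpb
    omega
  obtain ⟨k₁, hk₁, hj₁⟩ := exists_link (r := r) (A := c.A) (R₀ := c.R₀) c.U_card emA_injective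
    (Sum.inl j) hXc
  obtain ⟨k₂, hk₂, hj₂⟩ := exists_link (r := Function.swap r) (A := c.B) (R₀ := c.R₀) c.U_card
    emB_injective (Sum.inl j) hXc
  simp only [hX, mem_union, not_or] at hk₁ hk₂
  have hAs : StrongOn r (c.A ka) := c.base_strong (emA ka)
  have hBs : StrongOn r (c.B kb) := c.base_strong (emB kb)
  set Q := insert a (insert b P) with hQ
  set S₁ := c.A ka ∪ (c.B kb ∪ Q) with hS₁
  have hA₁ : c.A ka ⊆ S₁ := subset_union_left
  have hB₁ : c.B kb ⊆ S₁ := subset_union_left.trans subset_union_right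
  have hQ₁ : Q ⊆ S₁ := subset_union_right.trans subset_union_right
  have hRab : Rch r S₁ a b := (hab a (mem_insert_self _ _)).2.mono hQ₁
  have hpq : ∀ v ∈ S₁, Rch r S₁ a v ∧ Rch r S₁ v b := by
    intro v hv
    rcases mem_union.1 hv with hv | hv
    · exact ⟨(hAs a haA v hv).mono hA₁, ((hAs v hv a haA).mono hA₁).trans hRab⟩
    rcases mem_union.1 hv with hv | hv
    · exact ⟨hRab.trans ((hBs b hbB v hv).mono hB₁), (hBs v hv b hbB).mono hB₁⟩
    · exact ⟨(hab v hv).1.mono hQ₁, (hab v hv).2.mono hQ₁⟩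
  set Y := c.block (emA k₁) ∪ c.block (emB k₂) with hY
  have hA₂ : c.A k₁ ⊆ Y := subset_union_left.trans subset_union_left
  have hB₂ : c.B k₂ ⊆ Y :=
    (show c.B k₂ ⊆ c.block (emB k₂) from subset_union_left).trans subset_union_right
  have hS₂ : StrongOn r (S₁ ∪ Y) := by
    refine strongOn_union_of_abs (hB₁ hbB) hpq ((c.base_ne (emA k₁)).mono hA₂)
      ((c.abs (emA k₁)).union (c.abs (emB k₂))) ?_ ?_
    · intro v hv hg
      obtain ⟨s, hs, hvs⟩ : ∃ s ∈ c.A ka, r v s := by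
        rcases mem_union.1 hv with hv | hv
        · exact c.edgeA hk₁.2.1 hv hg
        · exact c.edgeA hk₂.2.1 hv hg
      exact ⟨s, hA₁ hs, hvs, (hAs s hs a haA).mono hA₁⟩
    · intro v hv hg
      obtain ⟨s, hs, hvs⟩ : ∃ s ∈ c.B kb, r s v := by
        rcases mem_union.1 hv with hv | hv
        · exact c.edgeB hk₁.2.2 hv hg
        · exact c.edgeB hk₂.2.2 hv hg
      exact ⟨s, hB₁ hs, hvs, (hBs b hbB s hs).mono hB₁⟩
  set S₀ := S₁ ∪ Y ∪ c.block (Sum.inl j) with hS₀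
  have hS₀s : StrongOn r S₀ := by
    refine hS₂.union_abs ⟨b, subset_union_left (hB₁ hbB)⟩ (c.abs (Sum.inl j)) ?_ ?_
    · intro v hv hg
      obtain ⟨s, hs, hvs⟩ := c.edgeA hj₁ hv hg
      exact ⟨s, subset_union_right (hA₂ hs), hvs⟩
    · intro v hv hg
      obtain ⟨s, hs, hvs⟩ := c.edgeB hj₂ hv hg
      exact ⟨s, subset_union_right (hB₂ hs), hvs⟩
  have hx₀ : x j ∈ S₀ := mem_union_right _ (mem_union_left _ (mem_singleton_self _))
  have hS₀c : S₀.card ≤ P.card + 300 := by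
    have h1 : S₀.card ≤ _ := card_union_le _ _
    have h2 : (S₁ ∪ Y).card ≤ _ := card_union_le _ _
    have h3 : S₁.card ≤ _ := card_union_le _ _
    have h4 := card_union_le (c.B kb) Q
    have h5 : Y.card ≤ _ := card_union_le _ _
    have h6 := card_insert_le a (insert b P)
    have h7 := card_insert_le b P
    have h8 := c.block_card (emA k₁)
    have h9 := c.block_card (emB k₂)
    have h10 := c.block_card (Sum.inl j)
    have h11 : (c.A ka).card ≤ 43 := c.base_card (emA ka)
    have h12 : (c.B kb).card ≤ 43 := c.base_card (emB kb)
    rw [← hQ] at h6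
    omega
  set own : Finset (Idx t N) := {Sum.inl j, emA ka, emB kb, emA k₁, emB k₂} with hown
  have hsub : S₀ ⊆ P ∪ own.biUnion c.block := by
    have hbl : ∀ i ∈ own, c.block i ⊆ P ∪ own.biUnion c.block := fun i hi =>
      (subset_biUnion_of_mem _ hi).trans subset_union_right
    have hbA := hbl (emA ka) (by simp [hown])
    have hbB' := hbl (emB kb) (by simp [hown])
    have hA' : c.A ka ⊆ c.block (emA ka) := subset_union_left
    have hB' : c.B kb ⊆ c.block (emB kb) := subset_union_left
    refine union_subset (union_subset (union_subset (hA'.trans hbA) (union_subset (hB'.trans hbB')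
      (insert_subset (hbA (hA' haA)) (insert_subset (hbB' (hB' hbB)) subset_union_left))))
      (union_subset (hbl _ ?_) (hbl _ ?_))) (hbl _ ?_) <;> simp [hown]
  have hownu : Disjoint own used := by
    rw [disjoint_left]
    intro i hi
    simp only [hown, mem_insert, mem_singleton] at hi
    rcases hi with rfl | rfl | rfl | rfl | rfl
    exacts [hju, hua, hub, hk₁.1, hk₂.1]
  have hPn : (P.card + 300) * K ≤ Fintype.card V + 400 * K := by
    have h1 := card_le_univ W
    have h2 : P.card * k ≤ Fintype.card V + 2 * k := hPc.trans (by omega)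
    rcases le_or_gt P.card 2 with h3 | h3
    · exact (Nat.mul_le_mul_right K (by omega : P.card + 300 ≤ 400)).trans (by omega)
    · obtain ⟨d, hd⟩ := Nat.exists_eq_add_of_lt h3
      rw [hd] at h2 ⊢
      have h4 : (d + 1) * k ≤ Fintype.card V := by
        have : (2 + d + 1) * k = (d + 1) * k + 2 * k := by ring
        omega
      have h5 := Nat.mul_le_mul_left (d + 1) hKk
      have : (2 + d + 1 + 300) * K = (d + 1) * K + 302 * K := by ring
      omega
  obtain ⟨T, hTS, hxT, hTs, hTc, hTr⟩ : ∃ T ⊆ S₀, x j ∈ T ∧ StrongOn r T ∧ T.card ≤ ℓ j ∧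
      (T.card < ℓ j → T = S₀) := by
    rcases le_or_gt S₀.card (ℓ j) with h | h
    · exact ⟨S₀, Subset.rfl, hx₀, hS₀s, h, fun _ => rfl⟩
    · obtain ⟨T, h1, h2, h3, h4⟩ := hS₀s.exists_subset hs hx₀ hj h.le
      exact ⟨T, h1, h2, h3, h4.le, fun hh => absurd h4 hh.ne⟩
  have hTP : T ∩ c.core ⊆ P := by
    intro v hv
    obtain ⟨hv1, hv2⟩ := mem_inter.1 hv
    rcases mem_union.1 (hsub (hTS hv1)) with h | h
    · exact h
    · obtain ⟨i, -, hi⟩ := mem_biUnion.1 h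
      exact absurd hv2 (disjoint_left.1 (c.disjoint_core i) hi)
  refine ⟨⟨T, own, ka, kb⟩, P, ⟨hxT, hTs, hTc, ?_, ?_, ?_, ?_, ?_⟩, hownu, hPW, hTP, hPk _ hTP,
    e1, e2, e3, e4⟩
  · exact card_le_five
  · intro i hi
    simpa [hown, emA, emB] using hi
  · exact hTS.trans (hsub.trans (union_subset_union (hPW.trans hWc) Subset.rfl))
  · intro h
    have hT := hTr h
    have h1 : S₁ ⊆ T := by
      rw [hT]
      exact subset_union_left.trans subset_union_left
    exact ⟨hA₁.trans h1, hB₁.trans h1, hpa, hpb⟩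
  · exact (Nat.mul_le_mul_right K ((card_le_card hTS).trans hS₀c)).trans hPn

end

noncomputable section

variable {V : Type} [Fintype V] {r : V → V → Prop} {t N : ℕ} {x : Fin t → V}

/-- Disjoint initial segments of the cycles with index in `J`, such that the unused part of the
core is still highly connected. -/
structure Stage (c : Config r t N x) (ℓ : Fin t → ℕ) (K : ℕ) (J : Finset (Fin t))
    (p : Fin t → Bit V t N) : Prop where
  piece : ∀ j ∈ J, Piece c ℓ K j (p j)
  own_disj : ∀ i ∈ J, ∀ j ∈ J, i ≠ j → Disjoint (p i).own (p j).own
  disj : ∀ i ∈ J, ∀ j ∈ J, i ≠ j → Disjoint (p i).S (p j).S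
  kc : Kc r (c.core \ J.biUnion fun i => (p i).S) (K + 4 * (t - J.card))
  sideA : Side r c.A c.R₀ c.U emA c.core (c.core ∩ J.biUnion fun i => (p i).S)
    (J.biUnion fun i => (p i).own) J.card
  sideB : Side (Function.swap r) c.B c.R₀ c.U emB c.core (c.core ∩ J.biUnion fun i => (p i).S)
    (J.biUnion fun i => (p i).own) J.card

theorem Stage.step (hs : Semi r) {c : Config r t N x} (ht : 0 < t) (hN : N = 10 ^ 7 * t)
    {ℓ : Fin t → ℕ} (hℓ : ∀ j, 3 ≤ ℓ j) {K : ℕ}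
    (hout : ∀ v, c.R.card + t < (outN r v).card)
    (hin : ∀ v, c.R.card + t < (outN (Function.swap r) v).card) {J : Finset (Fin t)}
    {p : Fin t → Bit V t N} (h : Stage c ℓ K J p) {j : Fin t} (hj : j ∉ J) :
    ∃ p', Stage c ℓ K (insert j J) p' := by
  have hJt : J.card < t := by
    have := card_le_univ (insert j J)
    rw [card_insert_of_notMem hj, Fintype.card_fin] at this
    omega
  have hu : (J.biUnion fun i => (p i).own).card ≤ 5 * t := by
    have := card_biUnion_le_card_mul J (fun i => (p i).own) 5 fun i hi => (h.piece i hi).own_card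
    omega
  have hju : Sum.inl j ∉ J.biUnion fun i => (p i).own := by
    intro hh
    obtain ⟨i, hi, hji⟩ := mem_biUnion.1 hh
    exact hj ((h.piece i hi).own_inl j hji ▸ hi)
  have hAc : ∀ k, Disjoint (c.A k) c.core := fun k =>
    (c.disjoint_core (emA k)).mono_left subset_union_left
  have hBc : ∀ k, Disjoint (c.B k) c.core := fun k =>
    (c.disjoint_core (emB k)).mono_left subset_union_left
  obtain ⟨q, P, hq, hqu, hPW, hqP, hkc, e1, e2, e3, e4⟩ := exists_piece_in hs c ht hN (hℓ j)
    (W := c.core \ J.biUnion fun i => (p i).S) sdiff_subset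
    (K := K) (k := K + 4 * (t - (insert j J).card)) (by omega)
    (by
      rw [card_insert_of_notMem hj]
      exact h.kc.mono (by omega)) hu hju
    (fun s hs' => by
      rw [← sdiff_inter_self_left]
      exact h.sideA.exists_edge rfl hs' (by have := hout s; omega))
    (fun s hs' => by
      rw [← sdiff_inter_self_left]
      exact h.sideB.exists_edge rfl hs' (by have := hin s; omega))
  set p' := Function.update p j q with hp'
  have hpj : p' j = q := Function.update_self _ _ _
  have hpi : ∀ i ∈ J, p' i = p i := fun i hi =>
    Function.update_of_ne (by rintro rfl; exact hj hi) _ _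
  have hbS : ((insert j J).biUnion fun i => (p' i).S) = q.S ∪ J.biUnion fun i => (p i).S := by
    rw [biUnion_insert, hpj]
    exact congrArg _ (biUnion_congr rfl fun i hi => by rw [hpi i hi])
  have hbo : ((insert j J).biUnion fun i => (p' i).own) = q.own ∪ J.biUnion fun i => (p i).own := by
    rw [biUnion_insert, hpj]
    exact congrArg _ (biUnion_congr rfl fun i hi => by rw [hpi i hi])
  have hX : c.core ∩ (q.S ∪ J.biUnion fun i => (p i).S) =
      (c.core ∩ J.biUnion fun i => (p i).S) ∪ (q.S ∩ c.core) := by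
    rw [inter_union_distrib_left, union_comm, inter_comm q.S]
  have hod : ∀ i ∈ J, Disjoint q.own (p i).own := fun i hi =>
    hqu.mono_right (subset_biUnion_of_mem (fun i => (p i).own) hi)
  have hSd : ∀ i ∈ J, Disjoint q.S (p i).S := by
    intro i hi
    rw [disjoint_left]
    intro v hv hvi
    rcases mem_union.1 (hq.sub hv) with h1 | h1
    · exact (mem_sdiff.1 (hPW (hqP (mem_inter.2 ⟨hv, h1⟩)))).2 (mem_biUnion.2 ⟨i, hi, hvi⟩)
    · obtain ⟨i₁, hi₁, hv₁⟩ := mem_biUnion.1 h1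
      rcases mem_union.1 ((h.piece i hi).sub hvi) with h2 | h2
      · exact disjoint_left.1 (c.disjoint_core i₁) hv₁ h2
      · obtain ⟨i₂, hi₂, hv₂⟩ := mem_biUnion.1 h2
        refine disjoint_left.1 (c.block_disj ?_) hv₁ hv₂
        rintro rfl
        exact disjoint_left.1 (hod i hi) hi₁ hi₂
  refine ⟨p', ?_, ?_, ?_, ?_, ?_, ?_⟩
  · intro i hi
    rcases mem_insert.1 hi with rfl | hi
    · rwa [hpj]
    · rw [hpi i hi]
      exact h.piece i hi
  · intro i hi i' hi' hne
    rcases mem_insert.1 hi with rfl | hiJ <;> rcases mem_insert.1 hi' with rfl | hi'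
    · exact absurd rfl hne
    · rw [hpj, hpi i' hi']
      exact hod i' hi'
    · rw [hpj, hpi i hiJ]
      exact (hod i hiJ).symm
    · rw [hpi i hiJ, hpi i' hi']
      exact h.own_disj i hiJ i' hi' hne
  · intro i hi i' hi' hne
    rcases mem_insert.1 hi with rfl | hiJ <;> rcases mem_insert.1 hi' with rfl | hi'
    · exact absurd rfl hne
    · rw [hpj, hpi i' hi']
      exact hSd i' hi'
    · rw [hpj, hpi i hiJ]
      exact (hSd i hiJ).symm
    · rw [hpi i hiJ, hpi i' hi']
      exact h.disj i hiJ i' hi' hne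
  · have : (c.core \ J.biUnion fun i => (p i).S) \ (q.S ∩ c.core) =
        c.core \ (q.S ∪ J.biUnion fun i => (p i).S) := by
      ext v
      simp only [mem_sdiff, mem_inter, mem_union]
      tauto
    rw [hbS, ← this]
    exact hkc
  · rw [hbS, hbo, hX, card_insert_of_notMem hj]
    exact h.sideA.step hs c.U_card ht hN emA_injective hu (fun k => c.base_ne (emA k)) hAc
      subset_union_right hqP (by rwa [sdiff_inter_self_left]) e2
  · rw [hbS, hbo, hX, card_insert_of_notMem hj]
    exact h.sideB.step hs.swap c.U_card ht hN emB_injective hu (fun k => c.base_ne (emB k)) hBc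
      subset_union_right hqP (by rw [sdiff_inter_self_left]; exact e3) e4

theorem exists_stage (hs : Semi r) {c : Config r t N x} (ht : 0 < t) (hN : N = 10 ^ 7 * t)
    {ℓ : Fin t → ℕ} (hℓ : ∀ j, 3 ≤ ℓ j) {K : ℕ}
    (hout : ∀ v, c.R.card + t < (outN r v).card)
    (hin : ∀ v, c.R.card + t < (outN (Function.swap r) v).card)
    (hK : Kc r c.core (K + 4 * t)) (J : Finset (Fin t)) : ∃ p, Stage c ℓ K J p := by
  induction J using Finset.induction_on with
  | empty =>
    have hN0 : 0 < N := by omega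
    exact ⟨fun _ => ⟨∅, ∅, ⟨0, hN0⟩, ⟨0, hN0⟩⟩, by simp, by simp, by simp, by simpa using hK,
      ⟨by simp, by simp⟩, ⟨by simp, by simp⟩⟩
  | insert j J hj ih =>
    obtain ⟨p, hp⟩ := ih
    exact hp.step hs ht hN hℓ hout hin hj

end

noncomputable section

/-- The indices of the sets `A k` with `k ∈ G` and `B k` with `k ∈ H`. -/
def idxs {t N : ℕ} (G H : Finset (Fin N)) : Finset (Idx t N) := G.image emA ∪ H.image emB

theorem card_idxs_le {t N : ℕ} (G H : Finset (Fin N)) :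
    (idxs G H : Finset (Idx t N)).card ≤ G.card + H.card :=
  (card_union_le _ _).trans (Nat.add_le_add card_image_le card_image_le)

theorem disjoint_left_of_idxs {t N : ℕ} {G H G' H' : Finset (Fin N)}
    (h : Disjoint (idxs (t := t) G H) (idxs G' H')) : Disjoint G G' := by
  rw [disjoint_left] at h ⊢
  exact fun k hk hk' => h (mem_union_left _ (mem_image_of_mem _ hk))
    (mem_union_left _ (mem_image_of_mem _ hk'))

theorem disjoint_right_of_idxs {t N : ℕ} {G H G' H' : Finset (Fin N)}
    (h : Disjoint (idxs (t := t) G H) (idxs G' H')) : Disjoint H H' := by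
  rw [disjoint_left] at h ⊢
  exact fun k hk hk' => h (mem_union_right _ (mem_image_of_mem _ hk))
    (mem_union_right _ (mem_image_of_mem _ hk'))

theorem exists_groups {t N : ℕ} (hN : N = 10 ^ 7 * t) (F₀ : Finset (Idx t N))
    (hF₀ : F₀.card ≤ 5 * t) (g : Fin t → ℕ) (hg : ∑ j, g j ≤ 10 ^ 6 * t)
    (X : Fin t → Finset (Idx t N)) (hX : ∀ j, 0 < g j → 5 * (X j).card ≤ N) :
    ∃ G H : Fin t → Finset (Fin N), (∀ j, (G j).card = g j) ∧ (∀ j, (H j).card = g j) ∧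
      (∀ j, Disjoint (idxs (G j) (H j)) F₀) ∧
      (∀ j, 0 < g j → Disjoint (idxs (G j) (H j)) (X j)) ∧
      ∀ i j, i ≠ j → Disjoint (idxs (t := t) (G i) (H i)) (idxs (G j) (H j)) := by
  have hpick : ∀ (emb : Fin N → Idx t N), Function.Injective emb → ∀ (Z : Finset (Idx t N)) (m : ℕ),
      Z.card + m ≤ N → ∃ G : Finset (Fin N), G.card = m ∧ Disjoint (G.image emb) Z := by
    intro emb hemb Z m hm
    have h1 : (univ.filter fun k => emb k ∈ Z).card ≤ Z.card :=
      card_le_card_of_injOn emb (fun k hk => (mem_filter.1 hk).2) hemb.injOn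
    have h2 := card_filter_add_card_filter_not (s := (univ : Finset (Fin N))) fun k => emb k ∈ Z
    rw [card_univ, Fintype.card_fin] at h2
    obtain ⟨G, hG, hGc⟩ := exists_subset_card_eq
      (show m ≤ (univ.filter fun k => ¬ emb k ∈ Z).card by omega)
    refine ⟨G, hGc, disjoint_left.2 fun i hi hiZ => ?_⟩
    obtain ⟨k, hk, rfl⟩ := mem_image.1 hi
    exact (mem_filter.1 (hG hk)).2 hiZ
  obtain ⟨Y, hY, hYd⟩ := exists_greedy (ι := Fin t) (α := Idx t N)
    (fun j Y _ => ∃ G H : Finset (Fin N), G.card = g j ∧ H.card = g j ∧ Y = idxs G H ∧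
      (0 < g j → Disjoint Y (X j)))
    (fun _ _ _ _ _ h => h) (fun j => 2 * g j) F₀ univ
    (by
      intro j _ F hF₀F hF
      rw [← mul_sum] at hF
      rcases Nat.eq_zero_or_pos (g j) with h0 | h0
      · exact ⟨∅, disjoint_empty_left _, by simp, ∅, ∅, by simp [h0], by simp [h0],
          by simp [idxs], fun _ => disjoint_empty_left _⟩
      · have h1 := card_union_le F (X j)
        have h2 := hX j h0
        have h3 : g j ≤ ∑ j, g j := single_le_sum (fun _ _ => Nat.zero_le _) (mem_univ j)
        obtain ⟨G, hG, hGd⟩ := hpick emA emA_injective (F ∪ X j) (g j) (by omega)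
        obtain ⟨H, hH, hHd⟩ := hpick emB emB_injective (F ∪ X j) (g j) (by omega)
        have hd : Disjoint (idxs G H) (F ∪ X j) := disjoint_union_left.2 ⟨hGd, hHd⟩
        have hc := card_idxs_le (t := t) G H
        exact ⟨idxs G H, (disjoint_union_right.1 hd).1, by omega, G, H, hG, hH, rfl,
          fun _ => (disjoint_union_right.1 hd).2⟩)
  have hY' := fun j => hY j (mem_univ j)
  choose h1 h2 G H h3 h4 h5 h6 using hY'
  exact ⟨G, H, h3, h4, fun j => h5 j ▸ h1 j, fun j hj => h5 j ▸ h6 j hj, fun i j hij =>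
    h5 i ▸ h5 j ▸ hYd i (mem_univ i) j (mem_univ j) hij⟩

variable {V : Type} [Fintype V] {r : V → V → Prop} {t N : ℕ} {x : Fin t → V} {ℓ : Fin t → ℕ}

theorem fit_of_bad_le {A : Fin N → Finset V} {T : Fin t → Finset V} {G : Fin t → Finset (Fin N)}
    (ht : 0 < t) (hn : 0 < ∑ j, ℓ j) (hG : ∀ j, (G j).card = 10 ^ 6 * t * ℓ j / ∑ j, ℓ j)
    (hGd : ∀ i j, i ≠ j → Disjoint (G i) (G j)) (hGA : ∀ j, ∀ k ∈ G j, A k ⊆ T j) {v : V}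
    (hv : bad r A v ≤ 200 * t) : Fit r ℓ T v := by
  set n := ∑ j, ℓ j with hn'
  set Z := univ.filter fun j => ∀ s ∈ T j, ¬ r v s with hZ
  have h1 : ∑ j ∈ Z, (G j).card ≤ 200 * t := by
    rw [← card_biUnion fun i _ j _ hij => hGd i j hij]
    refine (card_le_card fun k hk => ?_).trans hv
    obtain ⟨j, hj, hk⟩ := mem_biUnion.1 hk
    exact mem_avoided.2 fun a ha => (mem_filter.1 hj).2 a (hGA j k hk ha)
  have h2 : Z.card ≤ t := (card_le_univ Z).trans_eq (Fintype.card_fin t)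
  have h3 : 10 ^ 6 * t * ∑ j ∈ Z, ℓ j ≤ n * (∑ j ∈ Z, (G j).card + Z.card) := by
    rw [mul_sum, card_eq_sum_ones, ← sum_add_distrib, mul_sum]
    refine sum_le_sum fun j _ => ?_
    rw [hG]
    exact (Nat.lt_mul_div_succ _ hn).le
  have h4 : n * (∑ j ∈ Z, (G j).card + Z.card) ≤ n * (201 * t) := Nat.mul_le_mul_left _ (by omega)
  have h5 : (10 ^ 6 * ∑ j ∈ Z, ℓ j) * t ≤ (201 * n) * t := by
    calc _ = 10 ^ 6 * t * ∑ j ∈ Z, ℓ j := by ring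
      _ ≤ n * (201 * t) := h3.trans h4
      _ = _ := by ring
  have h6 := Nat.le_of_mul_le_mul_right h5 ht
  have h7 : defect r ℓ T v = ∑ j ∈ Z, ℓ j := sum_congr (by ext j; simp [hZ]) fun _ _ => rfl
  rw [Fit, h7]
  omega

theorem card_far_le {A : Fin N → Finset V} {R : Finset V} (h : Dominated r A R) (ht : 0 < t)
    (hN : N = 10 ^ 7 * t) {v : V} (hv : v ∉ R) :
    10 ^ 6 * (univ.filter fun w => w ∉ R ∧ 200 * t ≤ bad r A w).card ≤ (outN r v).card := by
  have h1 := h.card_bad_le hv (200 * t)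
  have h2 : 2 ^ 40 * (200 * (univ.filter fun w => w ∉ R ∧ 200 * t ≤ bad r A w).card) * t ≤
      10 ^ 7 * (outN r v).card * t := by
    calc _ = 2 ^ 40 * (200 * t * (univ.filter fun w => w ∉ R ∧ 200 * t ≤ bad r A w).card) := by ring
      _ ≤ N * (outN r v).card := h1
      _ = _ := by rw [hN]; ring
  have h3 := Nat.le_of_mul_le_mul_right h2 ht
  omega

theorem card_avoid_le {A : Fin N → Finset V} {R D T : Finset V} (h : Dominated r A R) (hRD : R ⊆ D)
    {k : Fin N} (hk : A k ⊆ T) :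
    16 * (univ.filter fun v => v ∉ D ∧ ∀ s ∈ T, ¬ r v s).card ≤ Fintype.card V := by
  rcases (univ.filter fun v => v ∉ D ∧ ∀ s ∈ T, ¬ r v s).eq_empty_or_nonempty with h0 | ⟨v, hv⟩
  · simp [h0]
  · have hv' := (mem_filter.1 hv).2.1
    have h1 := h k v fun hh => hv' (hRD hh)
    have h2 : (univ.filter fun v => v ∉ D ∧ ∀ s ∈ T, ¬ r v s).card ≤
        (univ.filter fun w => w ∉ R ∧ ∀ a ∈ A k, ¬ r w a).card := card_le_card fun w hw => by
      rw [mem_filter] at hw ⊢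
      exact ⟨hw.1, fun hh => hw.2.1 (hRD hh), fun a ha => hw.2.2 a (hk ha)⟩
    have h3 := card_le_univ (outN r v)
    omega

theorem Side.card_outN_sdiff {A : Fin N → Finset V} {R₀ R D S : Finset V} {U : Idx t N → Finset V}
    {emb : Fin N → Idx t N} {core : Finset V} {used : Finset (Idx t N)}
    (h : Side r A R₀ U emb core (core ∩ S) used t) (hcore : core = univ \ R) (hR₀ : R₀ ⊆ R)
    (hdom : Dominated r A R₀) (ht : 0 < t) (hN : N = 10 ^ 7 * t) (hD : D = S ∪ R)
    (hR : R.card ≤ 10 ^ 11 * t) (hout : ∀ v, 10 ^ 51 * t ≤ (outN r v).card) {v : V} (hv : v ∉ D)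
    (hb : 200 * t ≤ bad r A v) :
    6 * (univ.filter fun w => w ∉ R₀ ∧ 200 * t ≤ bad r A w).card <
      ((outN r v \ D) \ univ.filter fun w => w ∉ R₀ ∧ 200 * t ≤ bad r A w).card := by
  rw [hD, mem_union, not_or] at hv
  have h1 := h.far v (by rw [hcore]; simp [hv.2]) (fun hh => hv.1 (mem_inter.1 hh).2) hb
  have h2 := card_far_le hdom ht hN fun hh => hv.2 (hR₀ hh)
  have h3 := hout v
  set E := univ.filter fun w => w ∉ R₀ ∧ 200 * t ≤ bad r A w with hE
  have h4 : outN r v ⊆ (outN r v \ D) \ E ∪ (E ∪ (R ∪ (core ∩ S).filter (r v))) := by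
    intro w hw
    rw [mem_outN] at hw
    simp only [mem_union, mem_sdiff, mem_filter, mem_inter, mem_outN, hw, true_and, hD, hcore,
      mem_univ, and_true]
    tauto
  have h5 := (card_le_card h4).trans (card_union_le _ _)
  have h6 := card_union_le E (R ∪ (core ∩ S).filter (r v))
  have h7 := card_union_le R ((core ∩ S).filter (r v))
  omega

end

noncomputable section

variable {V : Type} [Fintype V] {r : V → V → Prop} {t N : ℕ} {x : Fin t → V} {ℓ : Fin t → ℕ}

theorem Stage.exists_valid {c : Config r t N x} (ht : 0 < t) (hN : N = 10 ^ 7 * t)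
    (hn : ∑ j, ℓ j = Fintype.card V) (hV : 10 ^ 51 * t ≤ Fintype.card V)
    (hout : ∀ v, 10 ^ 51 * t ≤ (outN r v).card)
    (hin : ∀ v, 10 ^ 51 * t ≤ (outN (Function.swap r) v).card) {p : Fin t → Bit V t N}
    (h : Stage c ℓ (10 ^ 50 * t) univ p) :
    ∃ T : Fin t → Finset V, Valid r ℓ x T ∧ ∀ j, (T j).card = ℓ j := by
  set n := Fintype.card V with hnV
  have hn0 : 0 < n := by omega
  set g : Fin t → ℕ := fun j => 10 ^ 6 * t * ℓ j / n with hg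
  have hpc : ∀ j, Piece c ℓ (10 ^ 50 * t) j (p j) := fun j => h.piece j (mem_univ j)
  have hgl : ∀ j, g j * 10 ^ 45 ≤ ℓ j := by
    intro j
    have h1 : g j * n ≤ 10 ^ 6 * t * ℓ j := Nat.div_mul_le_self _ _
    have h2 : (g j * 10 ^ 45) * (10 ^ 6 * t) ≤ ℓ j * (10 ^ 6 * t) := by
      calc _ = g j * (10 ^ 51 * t) := by ring
        _ ≤ g j * n := Nat.mul_le_mul_left _ hV
        _ ≤ _ := h1.trans_eq (by ring)
    exact Nat.le_of_mul_le_mul_right h2 (by omega)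
  have hroom : ∀ j, 0 < g j → (p j).S.card + 98 * g j < ℓ j := by
    intro j hj
    have h1 : n ≤ 10 ^ 6 * t * ℓ j :=
      (Nat.le_mul_of_pos_left n hj).trans (Nat.div_mul_le_self _ _)
    have h2 : ((p j).S.card * 10 ^ 50) * t ≤ (10 ^ 6 * ℓ j + 400 * 10 ^ 50) * t := by
      calc _ = (p j).S.card * (10 ^ 50 * t) := by ring
        _ ≤ n + 400 * (10 ^ 50 * t) := (hpc j).card
        _ ≤ 10 ^ 6 * t * ℓ j + 400 * (10 ^ 50 * t) := Nat.add_le_add_right h1 _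
        _ = _ := by ring
    have h3 := Nat.le_of_mul_le_mul_right h2 ht
    have h4 := hgl j
    omega
  have hgs : ∑ j, g j ≤ 10 ^ 6 * t := by
    have h1 : (∑ j, g j) * n ≤ 10 ^ 6 * t * n := by
      rw [sum_mul]
      calc _ ≤ ∑ j, 10 ^ 6 * t * ℓ j := sum_le_sum fun j _ => Nat.div_mul_le_self _ _
        _ = _ := by rw [← mul_sum, hn]
    exact Nat.le_of_mul_le_mul_right h1 hn0
  obtain ⟨G, H, hG, hH, hF, hX, hGH⟩ := exists_groups hN (univ.biUnion fun i => (p i).own) (by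
      have := card_biUnion_le_card_mul univ (fun i => (p i).own) 5 fun i _ => (hpc i).own_card
      rw [card_univ, Fintype.card_fin] at this
      omega) g hgs
    (fun j => conf r c.A c.R₀ c.U (p j).ra ∪ conf (Function.swap r) c.B c.R₀ c.U (p j).rb) (by
      intro j hj
      have h1 := card_union_le (conf r c.A c.R₀ c.U (p j).ra)
        (conf (Function.swap r) c.B c.R₀ c.U (p j).rb)
      have h2 := (hpc j).root (by have := hroom j hj; omega)
      have h3 := h2.2.2.1
      have h4 := h2.2.2.2
      rw [Pop] at h3 h4
      omega)
  set Y : Fin t → Finset (Idx t N) := fun j => idxs (G j) (H j) with hY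
  have hYc : ∀ j, (Y j).card ≤ 2 * g j := fun j => (card_idxs_le _ _).trans (by rw [hG, hH]; omega)
  have hY0 : ∀ j, (Y j).Nonempty → 0 < g j := fun j hj => by
    have := card_pos.2 hj
    have := hYc j
    omega
  set T : Fin t → Finset V := fun j => (p j).S ∪ (Y j).biUnion c.block with hT
  have hST : ∀ j, (p j).S ⊆ T j := fun j => subset_union_left
  have hYb : ∀ j, ((Y j).biUnion c.block).card ≤ 98 * g j := by
    intro j
    have h1 := card_biUnion_le_card_mul (Y j) c.block 49 fun i _ => c.block_card i
    have h2 := hYc j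
    omega
  have hTc : ∀ j, (T j).card ≤ (p j).S.card + 98 * g j := fun j =>
    (card_union_le _ _).trans (Nat.add_le_add_left (hYb j) _)
  have hown : ∀ i j, Disjoint (p i).own (Y j) := fun i j =>
    ((hF j).mono_right (subset_biUnion_of_mem (fun i => (p i).own) (mem_univ i))).symm
  have hbl : ∀ I I' : Finset (Idx t N), Disjoint I I' →
      Disjoint (I.biUnion c.block) (I'.biUnion c.block) := by
    intro I I' hd
    refine (disjoint_biUnion_left _ _ _).2 fun i hi => (disjoint_biUnion_right _ _ _).2
      fun i' hi' => c.block_disj ?_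
    rintro rfl
    exact disjoint_left.1 hd hi hi'
  have hSY : ∀ i j, Disjoint (p i).S ((Y j).biUnion c.block) := fun i j =>
    Disjoint.mono_left (hpc i).sub (disjoint_union_left.2
      ⟨(disjoint_biUnion_right _ _ _).2 fun i' _ => (c.disjoint_core i').symm,
        hbl _ _ (hown i j)⟩)
  have hbM : ∀ I : Finset (Idx t N), I.biUnion c.block ⊆ c.M := fun I =>
    biUnion_subset.2 fun i _ => c.block_subset i
  have hR₀ : c.R₀ ⊆ c.R := by
    refine Subset.trans ?_ c.M_subset_R
    rw [c.M_eq]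
    exact subset_union_left
  have hval : Valid r ℓ x T := by
    refine ⟨fun j => hST j (hpc j).mem, fun j => ?_, fun j => ?_, fun i j hij => ?_⟩
    · rcases (Y j).eq_empty_or_nonempty with h0 | h0
      · simpa [hT, h0] using (hpc j).strong
      have hg0 := hY0 j h0
      obtain ⟨hA, hB, -⟩ := (hpc j).root (by have := hroom j hg0; omega)
      refine (hpc j).strong.union_abs ⟨_, (hpc j).mem⟩ (abs_biUnion fun i _ => c.abs i) ?_ ?_
      · intro v hv hgv
        obtain ⟨i, hi, hvi⟩ := mem_biUnion.1 hv
        have hic := disjoint_left.1 (hX j hg0) hi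
        rw [mem_union, not_or] at hic
        obtain ⟨s, hs, hvs⟩ := c.edgeA hic.1 hvi hgv
        exact ⟨s, hA hs, hvs⟩
      · intro v hv hgv
        obtain ⟨i, hi, hvi⟩ := mem_biUnion.1 hv
        have hic := disjoint_left.1 (hX j hg0) hi
        rw [mem_union, not_or] at hic
        obtain ⟨s, hs, hvs⟩ := c.edgeB hic.2 hvi hgv
        exact ⟨s, hB hs, hvs⟩
    · rcases Nat.eq_zero_or_pos (g j) with h0 | h0
      · have h1 := hTc j
        have h2 := (hpc j).le
        omega
      · exact (hTc j).trans (hroom j h0).le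
    · exact disjoint_union_left.2 ⟨disjoint_union_right.2
        ⟨h.disj i (mem_univ i) j (mem_univ j) hij, hSY i j⟩,
        disjoint_union_right.2 ⟨(hSY j i).symm, hbl _ _ (hGH i j hij)⟩⟩
  have hTsub : univ.biUnion T ⊆ (univ.biUnion fun j => (p j).S) ∪ c.M := by
    refine biUnion_subset.2 fun j _ => union_subset_union ?_ (hbM _)
    exact subset_biUnion_of_mem (fun j => (p j).S) (mem_univ j)
  have hD : univ.biUnion T ∪ c.R = (univ.biUnion fun j => (p j).S) ∪ c.R := by
    refine Subset.antisymm (union_subset (hTsub.trans (union_subset_union Subset.rfl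
      c.M_subset_R)) subset_union_right) (union_subset_union ?_ Subset.rfl)
    exact biUnion_mono fun j _ => hST j
  have hfitA : ∀ v, bad r c.A v ≤ 200 * t → Fit r ℓ T v := fun v =>
    fit_of_bad_le (G := G) ht (by omega) (fun j => by rw [hG, hn])
      (fun i j hij => disjoint_left_of_idxs (hGH i j hij))
      fun j k hk => by
        refine Subset.trans ?_ ((subset_biUnion_of_mem c.block (x := emA k) ?_).trans
          subset_union_right)
        · exact subset_union_left
        · exact mem_union_left _ (mem_image_of_mem _ hk)
  have hfitB : ∀ v, bad (Function.swap r) c.B v ≤ 200 * t → Fit (Function.swap r) ℓ T v := fun v =>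
    fit_of_bad_le (G := H) ht (by omega) (fun j => by rw [hH, hn])
      (fun i j hij => disjoint_right_of_idxs (hGH i j hij))
      fun j k hk => by
        refine Subset.trans ?_ ((subset_biUnion_of_mem c.block (x := emB k) ?_).trans
          subset_union_right)
        · exact subset_union_left
        · exact mem_union_right _ (mem_image_of_mem _ hk)
  have hgA : ∀ v, Good t r c.A c.R₀ v → Fit r ℓ T v := fun v hv =>
    hfitA v (hv.2.trans (by omega))
  have hgB : ∀ v, Good t (Function.swap r) c.B c.R₀ v → Fit (Function.swap r) ℓ T v := fun v hv =>
    hfitB v (hv.2.trans (by omega))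
  have hRD : c.R ⊆ univ.biUnion T ∪ c.R := subset_union_right
  have hsideA : Side r c.A c.R₀ c.U emA c.core (c.core ∩ univ.biUnion fun i => (p i).S)
      (univ.biUnion fun i => (p i).own) t := by simpa using h.sideA
  have hsideB : Side (Function.swap r) c.B c.R₀ c.U emB c.core
      (c.core ∩ univ.biUnion fun i => (p i).S)
      (univ.biUnion fun i => (p i).own) t := by simpa using h.sideB
  have hfar : ∀ (r' : V → V → Prop) (A : Fin N → Finset V), Dominated r' A c.R₀ →
      10 ^ 6 * (univ.filter fun w => w ∉ c.R₀ ∧ 200 * t ≤ bad r' A w).card ≤ n := by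
    intro r' A hdom
    rcases (univ.filter fun w => w ∉ c.R₀ ∧ 200 * t ≤ bad r' A w).eq_empty_or_nonempty with
      h0 | ⟨v, hv⟩
    · simp [h0]
    · exact (card_far_le hdom ht hN (mem_filter.1 hv).2.1).trans (card_le_univ _)
  have hsz : 100 * (univ.biUnion T).card ≤ n := by
    have h1 : (univ.biUnion T).card ≤ ∑ j, ((p j).S.card + 98 * g j) :=
      card_biUnion_le.trans (sum_le_sum fun j _ => hTc j)
    rw [sum_add_distrib, ← mul_sum] at h1
    have h2 : ((∑ j, (p j).S.card) * 10 ^ 50) * t ≤ (n + 400 * (10 ^ 50 * t)) * t := by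
      calc _ = ∑ j, (p j).S.card * (10 ^ 50 * t) := by rw [← sum_mul]; ring
        _ ≤ ∑ _j : Fin t, (n + 400 * (10 ^ 50 * t)) := sum_le_sum fun j _ => (hpc j).card
        _ = _ := by simp [mul_comm]
    have h3 := Nat.le_of_mul_le_mul_right h2 ht
    omega
  refine hval.complete (hn.trans hnV) (by omega) (by omega) (M := c.M) (U := c.Pv)
    (EA := univ.filter fun w => w ∉ c.R₀ ∧ 200 * t ≤ bad r c.A w)
    (EB := univ.filter fun w => w ∉ c.R₀ ∧ 200 * t ≤ bad (Function.swap r) c.B w)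
    (D := univ.biUnion T ∪ c.R) ?_ c.Pv_card ?_ c.Pv_M c.Pv_disj ?_ ?_ ?_ ?_ ?_ ?_ ?_
  · have h1 := hfar r c.A c.domA
    have h2 := hfar _ c.B c.domB
    have h3 := c.M_card
    omega
  · intro y hy
    have hPR : c.Pv y ⊆ c.R := by
      rw [c.R_eq]
      exact (subset_biUnion_of_mem c.Pv hy).trans subset_union_right
    refine (disjoint_biUnion_right _ _ _).2 fun j _ => disjoint_union_right.2
      ⟨Disjoint.mono_right (hpc j).sub (disjoint_union_right.2 ⟨?_, ?_⟩), ?_⟩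
    · exact disjoint_sdiff.mono_left hPR
    · exact (c.Pv_M y hy).mono_right (hbM _)
    · exact (c.Pv_M y hy).mono_right (hbM _)
  · intro y hy
    exact ⟨(c.Pv_abs y hy).1.imp (fun v _ => hgA v) fun v _ => hgB v,
      (c.Pv_abs y hy).2.imp (fun v _ => hgA v) fun v _ => hgB v⟩
  · rw [c.R_eq]
  · intro v hv hE
    refine hfitA v ?_
    by_contra hlt
    exact hE (mem_filter.2 ⟨mem_univ _, fun hh => hv (hRD (hR₀ hh)), by omega⟩)
  · intro v hv hE
    refine hfitB v ?_
    by_contra hlt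
    exact hE (mem_filter.2 ⟨mem_univ _, fun hh => hv (hRD (hR₀ hh)), by omega⟩)
  · intro v hv hvD
    exact hsideA.card_outN_sdiff rfl hR₀ c.domA ht hN hD c.R_card hout hvD (mem_filter.1 hv).2.2
  · intro v hv hvD
    exact hsideB.card_outN_sdiff rfl hR₀ c.domB ht hN hD c.R_card hin hvD (mem_filter.1 hv).2.2
  · intro j hj
    obtain ⟨hA, hB, -⟩ := (hpc j).root ((card_le_card (hST j)).trans_lt hj)
    rw [hn]
    exact ⟨card_avoid_le c.domA (hR₀.trans hRD) (hA.trans (hST j)),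
      card_avoid_le c.domB (hR₀.trans hRD) (hB.trans (hST j))⟩

theorem exists_valid (hs : Semi r) (ht : 0 < t) (hx : Function.Injective x) (hℓ : ∀ j, 3 ≤ ℓ j)
    (hn : ∑ j, ℓ j = Fintype.card V) (hV : 10 ^ 51 * t + 1 ≤ Fintype.card V)
    (hK : Kc r univ (10 ^ 51 * t)) :
    ∃ T : Fin t → Finset V, Valid r ℓ x T ∧ ∀ j, (T j).card = ℓ j := by
  have hout := hK.le_outN hs hV
  have hin := hK.swap.le_outN hs.swap hV
  obtain ⟨c⟩ := exists_config hs ht rfl hx (fun v => by have := hout v; omega)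
    fun v => by have := hin v; omega
  have hR := c.R_card
  obtain ⟨p, hp⟩ := exists_stage hs (c := c) ht rfl hℓ (K := 10 ^ 50 * t)
    (fun v => by have := hout v; omega) (fun v => by have := hin v; omega)
    (hK.sdiff c.R (by omega)) univ
  exact hp.exists_valid ht rfl hn (by omega) hout hin

end

theorem kc_of_stronglyConnOn {V : Type} [Fintype V] {D : Digr V} {k : ℕ} (h : D.StronglyConnOn Set.univ k) :
    Kc D.Adj univ k := by
  intro S hS u hu v hv
  rcases eq_or_ne u v with rfl | huv
  · exact ReflTransGen.refl
  have hS' : (S : Set V) ⊆ Set.univ \ {u, v} := by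
    intro w hw
    refine ⟨Set.mem_univ _, ?_⟩
    rintro (rfl | rfl)
    · exact (mem_sdiff.1 hu).2 hw
    · exact (mem_sdiff.1 hv).2 hw
  obtain ⟨l, -, hchain, hmem, hhead, hlast⟩ := h.2 u (Set.mem_univ _) v (Set.mem_univ _) huv S hS'
    (by rwa [Set.ncard_coe_finset])
  obtain ⟨l', rfl⟩ := List.head?_eq_some_iff.1 hhead
  refine rch_of_isChain hchain (fun a ha => ?_) v (List.mem_of_getLast? hlast)
  have := hmem a ha
  simpa using this

theorem Cyc.isCycleOn {V : Type} {D : Digr V} {l : List V} (h : Cyc D.Adj l) (hl : 3 ≤ l.length)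
    {C : Finset V} (hC : l.toFinset = C) : D.IsCycleOn (C : Set V) l := by
  refine ⟨hl, h.1, fun v => by simp [← hC], h.2.1, ?_⟩
  have hne : l ≠ [] := by
    rintro rfl
    simp at hl
  exact ⟨l.getLast hne, l.head hne, List.getLast?_eq_some_getLast hne, List.head?_eq_some_head hne,
    h.2.2 _ (List.getLast?_eq_some_getLast hne) _ (List.head?_eq_some_head hne)⟩

end SemicompleteCycles

/-- Every strongly `10⁵¹ t`-connected `n`-vertex semicomplete digraph contains,
for any lengths `ℓ₁,…,ℓ_t ≥ 3` summing to `n` and any distinct vertices `x₁,…,x_t`,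
pairwise vertex-disjoint cycles `C₁,…,C_t` with `x_i ∈ V(C_i)` and `|V(C_i)| = ℓ_i`. -/
theorem stmt1 {V : Type} [Fintype V] (n t : ℕ) (ℓ : Fin t → ℕ)
    (hℓ : ∀ i, 3 ≤ ℓ i) (hsum : ∑ i, ℓ i = n)
    (D : Digr V) (hD : D.IsSemicomplete) (hn : Fintype.card V = n)
    (hconn : D.StronglyConnOn Set.univ (10 ^ 51 * t))
    (x : Fin t → V) (hx : Function.Injective x) :
    ∃ C : Fin t → Set V,
      (∀ i j, i ≠ j → Disjoint (C i) (C j)) ∧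
      ∀ i, x i ∈ C i ∧ (C i).ncard = ℓ i ∧ ∃ l, D.IsCycleOn (C i) l := by
  classical
  have ht : 0 < t := by
    rcases Nat.eq_zero_or_pos t with rfl | ht
    · have := hconn.1
      rw [Set.ncard_univ, Nat.card_eq_fintype_card] at this
      simp at hsum
      omega
    · exact ht
  have hV : 10 ^ 51 * t + 1 ≤ Fintype.card V := by
    have := hconn.1
    rwa [Set.ncard_univ, Nat.card_eq_fintype_card] at this
  obtain ⟨T, hT, hTc⟩ := SemicompleteCycles.exists_valid (r := D.Adj) hD ht hx hℓ
    (hsum.trans hn.symm) hV (SemicompleteCycles.kc_of_stronglyConnOn hconn)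
  refine ⟨fun i => T i, fun i j hij => Finset.disjoint_coe.2 (by convert hT.disj i j hij), fun i =>
    ⟨hT.mem i, by rw [Set.ncard_coe_finset, hTc], ?_⟩⟩
  obtain ⟨l, hl, -, hlT, hlc⟩ := (hT.strong i).exists_cyc hD (hT.mem i) (hℓ i) (hTc i).ge
  refine ⟨l, hl.isCycleOn (by rw [hlc]; exact hℓ i) (Finset.eq_of_subset_of_card_le hlT ?_)⟩
  rw [List.toFinset_card_of_nodup hl.1, hlc, hTc]
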